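/- arXiv:1706.02783 — 5 statements merged into one kernel-verified Lean document; each statement's English description precedes it below -/
import Mathlib

section
/- Let p be a prime and let n, m be positive integers with p ≥ m ≥ n ≥ 2. Let X ⊆ Z_p be a set of n elements. Choose a, b independently and uniformly at random from Z_p and define the random hash function h : Z_p → Z_m by h(x) = (lift_p(a·x + b)) mod m, where lift_p : Z_p → {0,1,...,p−1} is the canonical representative. Let M = max over y ∈ Z_m of |{x ∈ X : h(x) = y}|. Then there is an absolute constant C (independent of p, m, n and X) such that E[M] ≤ C · (n · log n)^(1/3). -/
theorem sum_inv_card_fiber {ι κ : Type*} [DecidableEq ι] [DecidableEq κ] (S : Finset ι) (f : ι → κ) :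
    ∑ x ∈ S, (1 / ((S.filter fun y => f y = f x).card : ℝ)) = ((S.image f).card : ℝ) := by
  rw [← Finset.sum_fiberwise_of_maps_to (t := S.image f) (g := f)
    (fun x hx => Finset.mem_image_of_mem f hx), Finset.card_eq_sum_ones, Nat.cast_sum]
  refine Finset.sum_congr rfl fun k hk => ?_
  obtain ⟨x₀, hx₀, rfl⟩ := Finset.mem_image.1 hk
  have h : ∀ x ∈ S.filter (fun y => f y = f x₀),
      (1 / ((S.filter fun y => f y = f x).card : ℝ))
        = 1 / ((S.filter fun y => f y = f x₀).card : ℝ) := by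
    intro x hx
    rw [(Finset.mem_filter.1 hx).2]
  rw [Finset.sum_congr rfl h, Finset.sum_const, nsmul_eq_mul]
  have : ((S.filter fun y => f y = f x₀).card : ℝ) ≠ 0 := by
    have : 0 < (S.filter fun y => f y = f x₀).card :=
      Finset.card_pos.2 ⟨x₀, by simp [hx₀]⟩
    positivity
  rw [mul_one_div_cancel this, Nat.cast_one]

/-- The weight of an ordered pair of distinct elements in a common fibre of `f` on `S`: the
reciprocal of the size of that fibre. -/
noncomputable def fiberWeight {ι κ : Type*} [DecidableEq ι] [DecidableEq κ]
    (S : Finset ι) (f : ι → κ) (x x' : ι) : ℝ :=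
  if x ∈ S ∧ x' ∈ S ∧ f x' = f x ∧ x' ≠ x then
    1 / ((S.filter fun y => f y = f x).card : ℝ) else 0

theorem card_sub_card_image_le_sum_fiberWeight {ι κ : Type*} [DecidableEq ι] [DecidableEq κ]
    (X S : Finset ι) (hS : S ⊆ X) (f : ι → κ) :
    (S.card : ℝ) - (S.image f).card ≤ ∑ x ∈ X, ∑ x' ∈ X, fiberWeight S f x x' := by
  have hnn : ∀ x x', 0 ≤ fiberWeight S f x x' := by
    intro x x'; unfold fiberWeight; split_ifs <;> positivity
  calc (S.card : ℝ) - (S.image f).card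
      = ∑ x ∈ S, (1 - 1 / ((S.filter fun y => f y = f x).card : ℝ)) := by
        rw [Finset.sum_sub_distrib, sum_inv_card_fiber]; simp
    _ ≤ ∑ x ∈ S, ∑ x' ∈ X, fiberWeight S f x x' := by
        refine Finset.sum_le_sum fun x hx => ?_
        set T := S.filter fun y => f y = f x with hT
        have hxT : x ∈ T := by simp [hT, hx]
        have hpos : (0 : ℝ) < T.card := by
          exact_mod_cast Finset.card_pos.2 ⟨x, hxT⟩
        have hsub : T.erase x ⊆ X := fun y hy =>
          hS (Finset.mem_filter.1 (Finset.mem_of_mem_erase hy)).1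
        refine le_trans ?_ (Finset.sum_le_sum_of_subset_of_nonneg hsub fun y _ _ => hnn x y)
        have : ∀ y ∈ T.erase x, fiberWeight S f x y = 1 / (T.card : ℝ) := by
          intro y hy
          have h1 := Finset.mem_filter.1 (Finset.mem_of_mem_erase hy)
          unfold fiberWeight
          rw [if_pos ⟨hx, h1.1, h1.2, Finset.ne_of_mem_erase hy⟩]
        rw [Finset.sum_congr rfl this, Finset.sum_const, nsmul_eq_mul,
          Finset.cast_card_erase_of_mem hxT]
        apply le_of_eq
        field_simp
    _ ≤ _ := Finset.sum_le_sum_of_subset_of_nonneg hS fun x _ _ =>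
        Finset.sum_nonneg fun y _ => hnn x y

theorem sum_fiberWeight_mul_le {ι κ : Type*} [DecidableEq ι] [DecidableEq κ]
    (X S S' : Finset ι) (f f' : ι → κ) :
    ∑ x ∈ X, ∑ x' ∈ X, fiberWeight S f x x' * fiberWeight S' f' x x'
      ≤ ((S ∩ S').image fun x => (f x, f' x)).card := by
  rw [← sum_inv_card_fiber]
  set T := S ∩ S' with hT
  have key : ∀ x ∈ X, ∑ x' ∈ X, fiberWeight S f x x' * fiberWeight S' f' x x'
      ≤ if x ∈ T then 1 / ((T.filter fun y => (f y, f' y) = (f x, f' x)).card : ℝ) else 0 := by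
    intro x _
    split_ifs with hx
    · set R := T.filter fun y => (f y, f' y) = (f x, f' x) with hR
      have hxR : x ∈ R := by simp [hR, hx]
      have hRpos : (0 : ℝ) < R.card := by exact_mod_cast Finset.card_pos.2 ⟨x, hxR⟩
      have hRf : (R.card : ℝ) ≤ (S.filter fun y => f y = f x).card := by
        exact_mod_cast Finset.card_le_card fun y hy => by
          simp only [hR, hT, Finset.mem_filter, Finset.mem_inter, Prod.mk.injEq] at hy ⊢
          exact ⟨hy.1.1, hy.2.1⟩
      have hRf' : (R.card : ℝ) ≤ (S'.filter fun y => f' y = f' x).card := by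
        exact_mod_cast Finset.card_le_card fun y hy => by
          simp only [hR, hT, Finset.mem_filter, Finset.mem_inter, Prod.mk.injEq] at hy ⊢
          exact ⟨hy.1.2, hy.2.2⟩
      have hterm : ∀ x' ∈ X, fiberWeight S f x x' * fiberWeight S' f' x x'
          ≤ if x' ∈ R then (1 / (R.card : ℝ)) * (1 / (R.card : ℝ)) else 0 := by
        intro x' _
        unfold fiberWeight
        by_cases h1 : x ∈ S ∧ x' ∈ S ∧ f x' = f x ∧ x' ≠ x
        · by_cases h2 : x ∈ S' ∧ x' ∈ S' ∧ f' x' = f' x ∧ x' ≠ x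
          · have : x' ∈ R := by
              simp [hR, hT, h1.2.1, h2.2.1, h1.2.2.1, h2.2.2.1]
            rw [if_pos h1, if_pos h2, if_pos this]
            gcongr
          · rw [if_neg h2, mul_zero]; split_ifs <;> positivity
        · rw [if_neg h1, zero_mul]; split_ifs <;> positivity
      refine (Finset.sum_le_sum hterm).trans ?_
      rw [← Finset.sum_filter, Finset.sum_const, nsmul_eq_mul]
      have : ((X.filter fun y => y ∈ R).card : ℝ) ≤ R.card := by
        exact_mod_cast Finset.card_le_card fun y hy => (Finset.mem_filter.1 hy).2
      calc _ ≤ (R.card : ℝ) * ((1 / (R.card : ℝ)) * (1 / (R.card : ℝ))) := by gcongr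
        _ = _ := by field_simp
    · apply le_of_eq
      refine Finset.sum_eq_zero fun x' _ => ?_
      unfold fiberWeight
      by_cases h1 : x ∈ S
      · have h2 : x ∉ S' := fun h => hx (Finset.mem_inter.2 ⟨h1, h⟩)
        simp [h2]
      · simp [h1]
  refine (Finset.sum_le_sum key).trans ?_
  rw [← Finset.sum_filter]
  exact Finset.sum_le_sum_of_subset_of_nonneg
    (fun x hx => (Finset.mem_filter.1 hx).2) fun x _ _ => by positivity

theorem card_image_mod_le_gcd {ι : Type*} [DecidableEq ι] (T : Finset ι) (i j : ℕ)
    (hi : 0 < i) (t t' : ι → ℕ)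
    (h : ∀ x ∈ T, ∀ y ∈ T, (j : ℤ) * t x - i * t' x = j * t y - i * t' y) :
    (T.image fun x => (t x % i, t' x % j)).card ≤ Nat.gcd i j := by
  obtain ⟨g, i', j', hg, hcop, rfl, rfl⟩ := Nat.exists_coprime' (Nat.gcd_pos_of_pos_left j hi)
  have hi' : 0 < i' := Nat.pos_of_mul_pos_right hi
  have hgcd : Nat.gcd (i' * g) (j' * g) = g := by
    rw [Nat.gcd_mul_right, hcop, one_mul]
  rw [hgcd]
  have hdiff : ∀ x ∈ T, ∀ y ∈ T, (j' : ℤ) * ((t x : ℤ) - t y) = i' * ((t' x : ℤ) - t' y) := by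
    intro x hx y hy
    have h1 := h x hx y hy
    have hg0 : (g : ℤ) ≠ 0 := by exact_mod_cast hg.ne'
    apply mul_left_cancel₀ hg0
    push_cast at h1
    linear_combination h1
  have hmod : ∀ x ∈ T, ∀ y ∈ T, t x % i' = t y % i' := by
    intro x hx y hy
    have : (i' : ℤ) ∣ (t x : ℤ) - t y :=
      (Int.isCoprime_iff_gcd_eq_one.2 (by simpa using hcop)).dvd_of_dvd_mul_left
        (Dvd.intro _ (hdiff x hx y hy).symm)
    exact (Nat.modEq_iff_dvd.2 this : t y ≡ t x [MOD i']).symm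
  refine (Finset.card_le_card_of_injOn (t := Finset.range g) (fun q => q.1 / i') ?_ ?_).trans_eq
    (Finset.card_range g)
  · intro q hq
    obtain ⟨x, hx, rfl⟩ := Finset.mem_image.1 hq
    simp only [Finset.coe_range, Set.mem_Iio]
    rw [Nat.div_lt_iff_lt_mul hi', mul_comm g]
    exact Nat.mod_lt _ hi
  · intro q hq r hr hqr
    obtain ⟨x, hx, rfl⟩ := Finset.mem_image.1 hq
    obtain ⟨y, hy, rfl⟩ := Finset.mem_image.1 hr
    simp only at hqr
    have e1 : t x % (i' * g) = t y % (i' * g) := by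
      rw [← Nat.div_add_mod (t x % (i' * g)) i', ← Nat.div_add_mod (t y % (i' * g)) i', hqr,
        Nat.mod_mul_right_mod, Nat.mod_mul_right_mod, hmod x hx y hy]
    have e2 : t' x % (j' * g) = t' y % (j' * g) := by
      have hd : ((i' * g : ℕ) : ℤ) ∣ (t x : ℤ) - t y :=
        (Nat.modEq_iff_dvd.1 (Eq.symm e1))
      obtain ⟨w, hw⟩ := hd
      refine (Nat.modEq_iff_dvd.2 ⟨w, ?_⟩ : t' y ≡ t' x [MOD j' * g]).symm
      have hi0 : (i' : ℤ) ≠ 0 := by exact_mod_cast hi'.ne'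
      apply mul_left_cancel₀ hi0
      rw [← hdiff x hx y hy, hw]; push_cast; ring
    rw [e1, e2]

theorem sum_gcd_le (N : ℕ) :
    ∑ i ∈ Finset.Ioc 0 N, ∑ j ∈ Finset.Ioc 0 N, (Nat.gcd i j : ℝ)
      ≤ (N : ℝ) ^ 2 * (1 + Real.log N) := by
  have h1 : ∀ i ∈ Finset.Ioc 0 N, ∀ j ∈ Finset.Ioc 0 N, (Nat.gcd i j : ℝ)
      ≤ ∑ d ∈ Finset.Ioc 0 N, (if d ∣ i then (1 : ℝ) else 0) * (if d ∣ j then 1 else 0) * d := by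
    intro i hi j hj
    have hi' := Finset.mem_Ioc.1 hi
    have hm : Nat.gcd i j ∈ Finset.Ioc 0 N := Finset.mem_Ioc.2
      ⟨Nat.gcd_pos_of_pos_left j hi'.1, (Nat.gcd_le_left j hi'.1).trans hi'.2⟩
    refine le_trans ?_ (Finset.single_le_sum (f := fun d : ℕ => (if d ∣ i then (1 : ℝ) else 0) *
      (if d ∣ j then 1 else 0) * d) (fun d _ => by positivity) hm)
    simp [Nat.gcd_dvd_left, Nat.gcd_dvd_right]
  have hc : ∀ d, ∑ i ∈ Finset.Ioc 0 N, (if d ∣ i then (1 : ℝ) else 0) = ((N / d : ℕ) : ℝ) := by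
    intro d
    rw [Finset.sum_boole, Nat.Ioc_filter_dvd_card_eq_div]
  calc _ ≤ ∑ i ∈ Finset.Ioc 0 N, ∑ j ∈ Finset.Ioc 0 N, ∑ d ∈ Finset.Ioc 0 N,
        (if d ∣ i then (1 : ℝ) else 0) * (if d ∣ j then 1 else 0) * d :=
        Finset.sum_le_sum fun i hi => Finset.sum_le_sum fun j hj => h1 i hi j hj
    _ = ∑ d ∈ Finset.Ioc 0 N, ((N / d : ℕ) : ℝ) * ((N / d : ℕ) : ℝ) * d := by
        rw [Finset.sum_congr rfl fun i _ => Finset.sum_comm, Finset.sum_comm]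
        refine Finset.sum_congr rfl fun d _ => ?_
        rw [← hc d, Finset.sum_mul_sum, Finset.sum_mul]
        simp_rw [Finset.sum_mul]
    _ ≤ ∑ d ∈ Finset.Ioc 0 N, (N : ℝ) ^ 2 * ((d : ℝ)⁻¹) := by
        refine Finset.sum_le_sum fun d hd => ?_
        have hd0 : (0 : ℝ) < d := by exact_mod_cast (Finset.mem_Ioc.1 hd).1
        have : ((N / d : ℕ) : ℝ) ≤ N / d := Nat.cast_div_le
        calc _ ≤ ((N : ℝ) / d) * (N / d) * d := by gcongr
          _ = _ := by field_simp
    _ = (N : ℝ) ^ 2 * ((harmonic N : ℚ) : ℝ) := by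
        rw [← Finset.mul_sum, harmonic_eq_sum_Icc]
        push_cast
        rfl
    _ ≤ _ := by
        gcongr
        exact harmonic_le_one_add_log N

open Classical in
/-- Ordered pairs of distinct elements of `X` whose difference is dilated by `β` into `[-W, W]`. -/
noncomputable def shortPairs {p : ℕ} (X : Finset (ZMod p)) (W : ℕ) (β : ZMod p) :
    Finset (ZMod p × ZMod p) :=
  (X ×ˢ X).filter fun q => q.2 ≠ q.1 ∧ ∃ w : ℤ, |w| ≤ W ∧ β * (q.2 - q.1) = w

theorem mem_shortPairs {p : ℕ} {X : Finset (ZMod p)} {W : ℕ} {β x x' : ZMod p} :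
    (x, x') ∈ shortPairs X W β ↔
      (x ∈ X ∧ x' ∈ X) ∧ x' ≠ x ∧ ∃ w : ℤ, |w| ≤ W ∧ β * (x' - x) = w := by
  simp [shortPairs]

theorem sum_mul_gcd_le (I P : Finset ℕ) (hI : I ⊆ P) (τ : ℕ → ℝ) :
    ∑ i ∈ I, ∑ j ∈ I, τ i * τ j * (Nat.gcd i j : ℝ)
      ≤ ∑ i ∈ I, τ i ^ 2 * ∑ j ∈ P, (Nat.gcd i j : ℝ) := by
  have h1 : ∑ i ∈ I, ∑ j ∈ I, τ i * τ j * (Nat.gcd i j : ℝ)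
      ≤ ∑ i ∈ I, ∑ j ∈ I, (τ i ^ 2 * (Nat.gcd i j : ℝ) / 2 + τ j ^ 2 * (Nat.gcd j i : ℝ) / 2) := by
    refine Finset.sum_le_sum fun i _ => Finset.sum_le_sum fun j _ => ?_
    rw [Nat.gcd_comm j i]
    have : (0 : ℝ) ≤ Nat.gcd i j := by positivity
    nlinarith [mul_nonneg this (sq_nonneg (τ i - τ j))]
  refine h1.trans ?_
  simp_rw [Finset.sum_add_distrib]
  rw [Finset.sum_comm (f := fun i j => τ j ^ 2 * (Nat.gcd j i : ℝ) / 2), ← Finset.sum_add_distrib]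
  refine Finset.sum_le_sum fun i _ => ?_
  rw [← Finset.sum_add_distrib, Finset.mul_sum]
  simp_rw [add_halves]
  exact Finset.sum_le_sum_of_subset_of_nonneg hI fun j _ _ => by positivity

theorem mul_val_sub_mul_val_eq {p : ℕ} [NeZero p] (L i j : ℕ) (hij : (i + j) * L < p)
    (β c c' x y : ZMod p)
    (hx : (i * β * x - c).val ≤ L) (hx' : (j * β * x - c').val ≤ L)
    (hy : (i * β * y - c).val ≤ L) (hy' : (j * β * y - c').val ≤ L) :
    (j : ℤ) * (i * β * x - c).val - i * (j * β * x - c').val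
      = j * (i * β * y - c).val - i * (j * β * y - c').val := by
  have hdvd : (p : ℤ) ∣ ((j : ℤ) * (i * β * x - c).val - i * (j * β * x - c').val)
      - (j * (i * β * y - c).val - i * (j * β * y - c').val) := by
    rw [← ZMod.intCast_zmod_eq_zero_iff_dvd]
    push_cast
    simp only [ZMod.natCast_zmod_val]
    ring
  have habs : |((j : ℤ) * (i * β * x - c).val - i * (j * β * x - c').val)
      - (j * (i * β * y - c).val - i * (j * β * y - c').val)| < p := by
    generalize (i * β * x - c).val = a at *
    generalize (j * β * x - c').val = a' at *
    generalize (i * β * y - c).val = b at *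
    generalize (j * β * y - c').val = b' at *
    have h1 : (j : ℤ) * a ≤ j * L := by gcongr
    have h2 : (i : ℤ) * a' ≤ i * L := by gcongr
    have h3 : (j : ℤ) * b ≤ j * L := by gcongr
    have h4 : (i : ℤ) * b' ≤ i * L := by gcongr
    have h5 : (0 : ℤ) ≤ (j : ℤ) * a := by positivity
    have h6 : (0 : ℤ) ≤ (i : ℤ) * a' := by positivity
    have h7 : (0 : ℤ) ≤ (j : ℤ) * b := by positivity
    have h8 : (0 : ℤ) ≤ (i : ℤ) * b' := by positivity
    have h9 : ((i : ℤ) + j) * L < p := by exact_mod_cast hij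
    rw [abs_lt]
    constructor <;> nlinarith
  exact sub_eq_zero.1 (Int.eq_zero_of_abs_lt_dvd hdvd habs)

theorem mem_shortPairs_of_fiberWeight_ne_zero {p : ℕ} [Fact p.Prime] (X : Finset (ZMod p))
    (L K i : ℕ) (hK : 0 < K) (hKi : K ≤ i) (hip : i < p) (β c x x' : ZMod p)
    (h : fiberWeight (X.filter fun x => (i * β * x - c).val ≤ L)
      (fun x => (i * β * x - c).val % i) x x' ≠ 0) :
    (x, x') ∈ shortPairs X (L / K) β := by
  unfold fiberWeight at h
  have h' := (ite_ne_right_iff.1 h).1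
  simp only [Finset.mem_filter] at h'
  obtain ⟨⟨hx, hxL⟩, ⟨hx', hxL'⟩, hmod, hne⟩ := h'
  obtain ⟨w, hw⟩ := Nat.modEq_iff_dvd.1 (Eq.symm hmod : _ ≡ _ [MOD i])
  have hi0 : (i : ZMod p) ≠ 0 := by
    rw [Ne, ZMod.natCast_eq_zero_iff]
    exact fun hd => absurd (Nat.le_of_dvd (hK.trans_le hKi) hd) (not_le.2 hip)
  refine mem_shortPairs.2 ⟨⟨hx, hx'⟩, hne, w, ?_, ?_⟩
  · have hb : (i : ℤ) * |w| ≤ L := by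
      rw [← Nat.abs_cast i, ← abs_mul, ← hw, abs_le]
      constructor <;> omega
    have hb' : |w| * K ≤ L := by
      refine le_trans ?_ hb
      rw [mul_comm]
      gcongr
    have := (Int.le_ediv_iff_mul_le (by exact_mod_cast hK)).2 hb'
    exact_mod_cast this
  · apply mul_left_cancel₀ hi0
    have := congrArg (Int.cast : ℤ → ZMod p) hw
    push_cast at this
    simp only [ZMod.natCast_zmod_val] at this
    rw [← this]; ring

theorem sum_le_card_shortPairs {p : ℕ} [Fact p.Prime] (X : Finset (ZMod p)) (L K k : ℕ)
    (hK : 0 < K) (hKk : 4 * K ≤ k) (hKp : 2 * K < p) (hL : 4 * K * L < p) (β : ZMod p)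
    (I : Finset ℕ) (hI : I ⊆ Finset.Ioc K (2 * K))
    (hc : ∀ i ∈ I, ∃ c : ZMod p, k ≤ (X.filter fun x => (i * β * x - c).val ≤ L).card) :
    ∑ i ∈ I, (k : ℝ) ^ 2 / (4 * ∑ j ∈ Finset.Ioc K (2 * K), (Nat.gcd i j : ℝ))
      ≤ ((shortPairs X (L / K) β).card : ℝ) := by
  classical
  choose! c hc using hc
  set g : ℕ → ℝ := fun i => ∑ j ∈ Finset.Ioc K (2 * K), (Nat.gcd i j : ℝ) with hg
  set S : ℕ → Finset (ZMod p) := fun i => X.filter fun x => (i * β * x - c i).val ≤ L with hS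
  set t : ℕ → ZMod p → ℕ := fun i x => (i * β * x - c i).val with ht
  set w : ℕ → ZMod p → ZMod p → ℝ := fun i => fiberWeight (S i) (fun x => t i x % i) with hw
  set τ : ℕ → ℝ := fun i => k / (2 * g i) with hτ
  have hIK : ∀ i ∈ I, K < i ∧ i ≤ 2 * K := fun i hi => Finset.mem_Ioc.1 (hI hi)
  have hgpos : ∀ i ∈ I, 0 < g i := by
    intro i hi
    refine Finset.sum_pos (fun j _ => ?_) ⟨i, hI hi⟩
    exact_mod_cast Nat.gcd_pos_of_pos_left j (hK.trans (hIK i hi).1)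
  have hA : ∀ i ∈ I, (k : ℝ) / 2 ≤ ∑ x ∈ X, ∑ x' ∈ X, w i x x' := by
    intro i hi
    refine le_trans ?_
      (card_sub_card_image_le_sum_fiberWeight X (S i) (Finset.filter_subset _ _) _)
    have h1 : ((S i).image fun x => t i x % i).card ≤ i := by
      refine (Finset.card_le_card (t := Finset.range i) fun q hq => ?_).trans_eq
        (Finset.card_range i)
      obtain ⟨x, _, rfl⟩ := Finset.mem_image.1 hq
      exact Finset.mem_range.2 (Nat.mod_lt _ (hK.trans (hIK i hi).1))
    have h2 : (((S i).image fun x => t i x % i).card : ℝ) ≤ 2 * K := by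
      exact_mod_cast h1.trans (hIK i hi).2
    have h3 : (k : ℝ) ≤ (S i).card := by exact_mod_cast hc i hi
    have h4 : (4 : ℝ) * K ≤ k := by exact_mod_cast hKk
    linarith
  have hB : ∀ i ∈ I, ∀ j ∈ I, ∑ x ∈ X, ∑ x' ∈ X, w i x x' * w j x x' ≤ Nat.gcd i j := by
    intro i hi j hj
    refine (sum_fiberWeight_mul_le X (S i) (S j) _ _).trans ?_
    refine Nat.cast_le.2 (card_image_mod_le_gcd _ i j (hK.trans (hIK i hi).1) (t i) (t j) ?_)
    intro x hx y hy
    simp only [hS, Finset.mem_inter, Finset.mem_filter] at hx hy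
    refine mul_val_sub_mul_val_eq L i j (lt_of_le_of_lt ?_ hL) β (c i) (c j) x y
      hx.1.2 hx.2.2 hy.1.2 hy.2.2
    have := (hIK i hi).2
    have := (hIK j hj).2
    gcongr
    omega
  set F : ZMod p → ZMod p → ℝ := fun x x' => ∑ i ∈ I, τ i * w i x x' with hF
  have hpt : ∀ x ∈ X, ∀ x' ∈ X, 2 * F x x' - F x x' ^ 2
      ≤ if (x, x') ∈ shortPairs X (L / K) β then 1 else 0 := by
    intro x _ x' _
    split_ifs with hm
    · nlinarith [sq_nonneg (F x x' - 1)]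
    · have : F x x' = 0 := by
        refine Finset.sum_eq_zero fun i hi => ?_
        have : w i x x' = 0 := by
          by_contra h0
          exact hm (mem_shortPairs_of_fiberWeight_ne_zero X L K i hK (hIK i hi).1.le
            ((hIK i hi).2.trans_lt hKp) β (c i) x x' h0)
        rw [this, mul_zero]
      simp [this]
  have hcard : ∑ x ∈ X, ∑ x' ∈ X, (if (x, x') ∈ shortPairs X (L / K) β then (1 : ℝ) else 0)
      = (shortPairs X (L / K) β).card := by
    rw [← Finset.sum_product', Finset.sum_boole]
    congr 2
    ext ⟨x, x'⟩
    simp only [Finset.mem_filter, Finset.mem_product, mem_shortPairs]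
    tauto
  have hF1 : ∑ x ∈ X, ∑ x' ∈ X, F x x' = ∑ i ∈ I, τ i * ∑ x ∈ X, ∑ x' ∈ X, w i x x' := by
    simp only [hF, Finset.mul_sum]
    rw [Finset.sum_congr rfl fun x _ => Finset.sum_comm, Finset.sum_comm]
  have hF2 : ∑ x ∈ X, ∑ x' ∈ X, F x x' ^ 2
      = ∑ i ∈ I, ∑ j ∈ I, τ i * τ j * ∑ x ∈ X, ∑ x' ∈ X, w i x x' * w j x x' := by
    have h : ∀ x x', F x x' ^ 2 = ∑ i ∈ I, ∑ j ∈ I, τ i * τ j * (w i x x' * w j x x') := by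
      intro x x'
      simp only [hF]
      rw [sq, Finset.sum_mul_sum]
      exact Finset.sum_congr rfl fun i _ => Finset.sum_congr rfl fun j _ => by ring
    simp_rw [h, Finset.mul_sum, Finset.sum_comm (s := X) (t := I)]
  have hτnn : ∀ i ∈ I, 0 ≤ τ i := fun i hi => by
    have := hgpos i hi
    simp only [hτ]; positivity
  calc ∑ i ∈ I, (k : ℝ) ^ 2 / (4 * g i)
      = 2 * ∑ i ∈ I, τ i * ((k : ℝ) / 2) - ∑ i ∈ I, τ i ^ 2 * g i := by
        rw [Finset.mul_sum, ← Finset.sum_sub_distrib]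
        refine Finset.sum_congr rfl fun i hi => ?_
        have := (hgpos i hi).ne'
        simp only [hτ]
        field_simp
        ring
    _ ≤ 2 * ∑ x ∈ X, ∑ x' ∈ X, F x x' - ∑ x ∈ X, ∑ x' ∈ X, F x x' ^ 2 := by
        rw [hF1, hF2]
        refine sub_le_sub (mul_le_mul_of_nonneg_left (Finset.sum_le_sum fun i hi =>
          mul_le_mul_of_nonneg_left (hA i hi) (hτnn i hi)) (by norm_num)) ?_
        refine le_trans ?_ (sum_mul_gcd_le I _ hI τ)
        exact Finset.sum_le_sum fun i hi => Finset.sum_le_sum fun j hj =>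
          mul_le_mul_of_nonneg_left (hB i hi j hj) (mul_nonneg (hτnn i hi) (hτnn j hj))
    _ = ∑ x ∈ X, ∑ x' ∈ X, (2 * F x x' - F x x' ^ 2) := by
        simp only [Finset.sum_sub_distrib, Finset.mul_sum]
    _ ≤ _ := by
        rw [← hcard]
        exact Finset.sum_le_sum fun x hx => Finset.sum_le_sum fun x' hx' => hpt x hx x' hx'

theorem sum_card_shortPairs_le {p : ℕ} [Fact p.Prime] (X : Finset (ZMod p)) (W : ℕ) :
    ∑ β ∈ Finset.univ.erase (0 : ZMod p), (shortPairs X W β).card ≤ X.card ^ 2 * (2 * W) := by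
  classical
  have h1 : ∀ β : ZMod p, (shortPairs X W β).card
      = ∑ q ∈ X ×ˢ X, if q ∈ shortPairs X W β then 1 else 0 := by
    intro β
    rw [Finset.sum_boole, Nat.cast_id]
    congr 1
    ext ⟨x, x'⟩
    simp only [Finset.mem_filter, Finset.mem_product, mem_shortPairs]
    tauto
  simp_rw [h1]
  rw [Finset.sum_comm, sq, ← Finset.card_product, ← smul_eq_mul, ← Finset.sum_const]
  refine Finset.sum_le_sum fun ⟨x, x'⟩ _ => ?_
  rw [Finset.sum_boole, Nat.cast_id]
  have hsub : (Finset.univ.erase (0 : ZMod p)).filter (fun β => (x, x') ∈ shortPairs X W β)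
      ⊆ ((Finset.Icc (-W : ℤ) W).erase 0).image fun w : ℤ => (w : ZMod p) * (x' - x)⁻¹ := by
    intro β hβ
    simp only [Finset.mem_filter, Finset.mem_erase, mem_shortPairs] at hβ
    obtain ⟨⟨hβ0, _⟩, _, hne, w, hwW, hw⟩ := hβ
    have hd : x' - x ≠ 0 := sub_ne_zero.2 hne
    refine Finset.mem_image.2 ⟨w, Finset.mem_erase.2 ⟨?_, Finset.mem_Icc.2 (abs_le.1 hwW)⟩, ?_⟩
    · rintro rfl
      simp [hβ0, hd] at hw
    · rw [← hw, mul_assoc, mul_inv_cancel₀ hd, mul_one]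
  refine (Finset.card_le_card hsub).trans (Finset.card_image_le.trans ?_)
  rw [Finset.card_erase_of_mem (by simp), Int.card_Icc]
  omega

/-- The largest number of points of the dilate `α • X` in a cyclic window `{c, c + 1, …, c + L}`. -/
def maxWindow {p : ℕ} [NeZero p] (X : Finset (ZMod p)) (L : ℕ) (α : ZMod p) : ℕ :=
  Finset.univ.sup fun c : ZMod p => (X.filter fun x => (α * x - c).val ≤ L).card

theorem maxWindow_le_card {p : ℕ} [NeZero p] (X : Finset (ZMod p)) (L : ℕ) (α : ZMod p) :
    maxWindow X L α ≤ X.card :=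
  Finset.sup_le fun _ _ => Finset.card_le_card (Finset.filter_subset _ _)

theorem exists_le_card_of_le_maxWindow {p : ℕ} [NeZero p] (X : Finset (ZMod p)) (L k : ℕ)
    (α : ZMod p) (h : k ≤ maxWindow X L α) :
    ∃ c : ZMod p, k ≤ (X.filter fun x => (α * x - c).val ≤ L).card := by
  obtain ⟨c, _, hc⟩ := Finset.exists_mem_eq_sup Finset.univ Finset.univ_nonempty
    fun c : ZMod p => (X.filter fun x => (α * x - c).val ≤ L).card
  exact ⟨c, h.trans hc.le⟩

theorem card_filter_mul_eq {p : ℕ} [Fact p.Prime] (u : ZMod p) (hu : u ≠ 0)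
    (Q : ZMod p → Prop) [DecidablePred Q] :
    ((Finset.univ.erase (0 : ZMod p)).filter fun β => Q (u * β)).card
      = ((Finset.univ.erase (0 : ZMod p)).filter Q).card := by
  refine Finset.card_bij (fun β _ => u * β) ?_ ?_ ?_
  · intro β hβ
    simp only [Finset.mem_filter, Finset.mem_erase, Finset.mem_univ, and_true] at hβ ⊢
    exact ⟨mul_ne_zero hu hβ.1, hβ.2⟩
  · intro a _ b _ hab
    exact mul_left_cancel₀ hu hab
  · intro b hb
    simp only [Finset.mem_filter, Finset.mem_erase, Finset.mem_univ, and_true] at hb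
    refine ⟨u⁻¹ * b, ?_, by rw [← mul_assoc, mul_inv_cancel₀ hu, one_mul]⟩
    simp only [Finset.mem_filter, Finset.mem_erase, Finset.mem_univ, and_true]
    rw [← mul_assoc, mul_inv_cancel₀ hu, one_mul]
    exact ⟨mul_ne_zero (inv_ne_zero hu) hb.1, hb.2⟩

theorem card_rich_mul_sum_le {p : ℕ} [Fact p.Prime] (X : Finset (ZMod p)) (L K k : ℕ)
    (hK : 0 < K) (hKk : 4 * K ≤ k) (hKp : 2 * K < p) (hL : 4 * K * L < p) :
    (((Finset.univ.erase (0 : ZMod p)).filter fun α => k ≤ maxWindow X L α).card : ℝ) *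
      ∑ i ∈ Finset.Ioc K (2 * K),
        (k : ℝ) ^ 2 / (4 * ∑ j ∈ Finset.Ioc K (2 * K), (Nat.gcd i j : ℝ))
      ≤ (X.card : ℝ) ^ 2 * (2 * (L / K : ℕ)) := by
  set v : ℕ → ℝ := fun i => (k : ℝ) ^ 2 / (4 * ∑ j ∈ Finset.Ioc K (2 * K), (Nat.gcd i j : ℝ))
  calc _ = ∑ i ∈ Finset.Ioc K (2 * K), ∑ β ∈ Finset.univ.erase (0 : ZMod p),
        if k ≤ maxWindow X L (i * β) then v i else 0 := by
        rw [Finset.mul_sum]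
        refine Finset.sum_congr rfl fun i hi => ?_
        have hi0 : (i : ZMod p) ≠ 0 := by
          rw [Ne, ZMod.natCast_eq_zero_iff]
          have := Finset.mem_Ioc.1 hi
          exact fun hd => absurd (Nat.le_of_dvd (by omega) hd) (by omega)
        rw [← Finset.sum_filter, Finset.sum_const, nsmul_eq_mul,
          card_filter_mul_eq (i : ZMod p) hi0 fun α => k ≤ maxWindow X L α]
    _ = ∑ β ∈ Finset.univ.erase (0 : ZMod p),
        ∑ i ∈ (Finset.Ioc K (2 * K)).filter fun i : ℕ => k ≤ maxWindow X L (i * β), v i := by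
        rw [Finset.sum_comm]
        simp_rw [Finset.sum_filter]
    _ ≤ ∑ β ∈ Finset.univ.erase (0 : ZMod p), ((shortPairs X (L / K) β).card : ℝ) := by
        refine Finset.sum_le_sum fun β _ => ?_
        refine sum_le_card_shortPairs X L K k hK hKk hKp hL β _ (Finset.filter_subset _ _) ?_
        intro i hi
        exact exists_le_card_of_le_maxWindow X L k _ (Finset.mem_filter.1 hi).2
    _ ≤ _ := by exact_mod_cast sum_card_shortPairs_le X (L / K)

theorem inv_log_le_sum_inv_sum_gcd (K : ℕ) (hK : 0 < K) :
    1 / (4 * (1 + Real.log (2 * K)))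
      ≤ ∑ i ∈ Finset.Ioc K (2 * K), 1 / ∑ j ∈ Finset.Ioc K (2 * K), (Nat.gcd i j : ℝ) := by
  set g : ℕ → ℝ := fun i => ∑ j ∈ Finset.Ioc K (2 * K), (Nat.gcd i j : ℝ) with hg
  have hne : (Finset.Ioc K (2 * K)).Nonempty := ⟨2 * K, Finset.mem_Ioc.2 ⟨by omega, le_rfl⟩⟩
  have hgpos : ∀ i ∈ Finset.Ioc K (2 * K), 0 < g i := by
    intro i hi
    refine Finset.sum_pos (fun j _ => ?_) hne
    exact_mod_cast Nat.gcd_pos_of_pos_left j (hK.trans (Finset.mem_Ioc.1 hi).1)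
  have h := Finset.sq_sum_div_le_sum_sq_div (Finset.Ioc K (2 * K)) (fun _ => (1 : ℝ)) hgpos
  simp only [one_pow, Finset.sum_const, Nat.card_Ioc, nsmul_eq_mul, mul_one] at h
  refine le_trans ?_ h
  have hsub : Finset.Ioc K (2 * K) ⊆ Finset.Ioc 0 (2 * K) := Finset.Ioc_subset_Ioc_left hK.le
  have hG : ∑ i ∈ Finset.Ioc K (2 * K), g i ≤ (2 * K : ℝ) ^ 2 * (1 + Real.log (2 * K)) := by
    have h0 := sum_gcd_le (2 * K)
    push_cast at h0
    refine le_trans ?_ h0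
    refine (Finset.sum_le_sum_of_subset_of_nonneg hsub fun i _ _ =>
      Finset.sum_nonneg fun j _ => by positivity).trans ?_
    exact Finset.sum_le_sum fun i _ =>
      Finset.sum_le_sum_of_subset_of_nonneg hsub fun j _ _ => by positivity
  have hGpos : 0 < ∑ i ∈ Finset.Ioc K (2 * K), g i := Finset.sum_pos hgpos hne
  have hK1 : (1 : ℝ) ≤ K := by exact_mod_cast hK
  have hlog : 0 ≤ Real.log (2 * K) := Real.log_nonneg (by linarith)
  have hsubK : ((2 * K - K : ℕ) : ℝ) = K := by congr 1; omega
  rw [hsubK, div_le_div_iff₀ (by positivity) hGpos, one_mul]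
  nlinarith

theorem card_rich_le {p : ℕ} [Fact p.Prime] (X : Finset (ZMod p)) (L n k : ℕ)
    (hX : X.card = n) (hk : 4 ≤ k) (hkn : k ≤ n) (hnp : n ≤ p) (hL : n * L < p) :
    (((Finset.univ.erase (0 : ZMod p)).filter fun α => k ≤ maxWindow X L α).card : ℝ)
      ≤ 256 * n * p * (1 + Real.log n) / (k : ℝ) ^ 3 := by
  set b : ℝ := (((Finset.univ.erase (0 : ZMod p)).filter fun α => k ≤ maxWindow X L α).card : ℝ)
    with hb
  have hb0 : 0 ≤ b := by positivity
  obtain ⟨K, hKdef⟩ : ∃ K, K = k / 4 := ⟨_, rfl⟩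
  have hK : 0 < K := by omega
  have hKk : 4 * K ≤ k := by omega
  have hkK : k ≤ 8 * K := by omega
  have h4 : 4 * K * L < p := lt_of_le_of_lt (Nat.mul_le_mul_right L (hKk.trans hkn)) hL
  have h1 := card_rich_mul_sum_le X L K k hK hKk (by omega) h4
  rw [← hb, hX] at h1
  have h2 := inv_log_le_sum_inv_sum_gcd K hK
  have hK1 : (1 : ℝ) ≤ K := by exact_mod_cast hK
  have hlogK : 0 ≤ Real.log (2 * K) := Real.log_nonneg (by linarith)
  have h2Kn : (2 * K : ℝ) ≤ n := by exact_mod_cast (by omega : 2 * K ≤ n)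
  have hlog : Real.log (2 * K) ≤ Real.log n := Real.log_le_log (by linarith) h2Kn
  have hk0 : (0 : ℝ) < k := by exact_mod_cast (by omega : 0 < k)
  have hn0 : (0 : ℝ) < n := by exact_mod_cast (by omega : 0 < n)
  have h3 : ∑ i ∈ Finset.Ioc K (2 * K),
        (k : ℝ) ^ 2 / (4 * ∑ j ∈ Finset.Ioc K (2 * K), (Nat.gcd i j : ℝ))
      = (k : ℝ) ^ 2 / 4 *
        ∑ i ∈ Finset.Ioc K (2 * K), 1 / ∑ j ∈ Finset.Ioc K (2 * K), (Nat.gcd i j : ℝ) := by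
    rw [Finset.mul_sum]
    refine Finset.sum_congr rfl fun i _ => ?_
    rw [div_mul_div_comm, mul_one]
  rw [h3] at h1
  have h5 : 1 / (4 * (1 + Real.log n)) ≤ 1 / (4 * (1 + Real.log (2 * K))) := by gcongr
  have h6 : b * ((k : ℝ) ^ 2 / 4 * (1 / (4 * (1 + Real.log n))))
      ≤ (n : ℝ) ^ 2 * (2 * (L / K : ℕ)) := by
    refine le_trans ?_ h1
    gcongr
    exact h5.trans h2
  have h7 : ((L / K : ℕ) : ℝ) ≤ 8 * p / (n * k) := by
    refine (Nat.cast_div_le).trans ?_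
    rw [div_le_div_iff₀ (by linarith) (by positivity)]
    have e1 : (n : ℝ) * L ≤ p := by exact_mod_cast hL.le
    have e2 : (k : ℝ) ≤ 8 * K := by exact_mod_cast hkK
    calc (L : ℝ) * (n * k) = (n * L) * k := by ring
      _ ≤ p * (8 * K) := by gcongr
      _ = _ := by ring
  have h8 : b * ((k : ℝ) ^ 2 / 4 * (1 / (4 * (1 + Real.log n))))
      ≤ (n : ℝ) ^ 2 * (2 * (8 * p / (n * k))) := h6.trans (by gcongr)
  have hl : 0 < 1 + Real.log n := by linarith
  rw [le_div_iff₀ (by positivity)]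
  have e : b * (k : ℝ) ^ 3 = b * ((k : ℝ) ^ 2 / 4 * (1 / (4 * (1 + Real.log n))))
      * (16 * (1 + Real.log n) * k) := by field_simp; ring
  rw [e]
  calc _ ≤ (n : ℝ) ^ 2 * (2 * (8 * p / (n * k))) * (16 * (1 + Real.log n) * k) := by gcongr
    _ = _ := by field_simp; ring

theorem sum_maxWindow_le {p : ℕ} [Fact p.Prime] (X : Finset (ZMod p)) (L n T : ℕ)
    (hX : X.card = n) (hn : 1 ≤ n) (hT : 3 ≤ T) (hnp : n ≤ p) (hL : n * L < p) :
    (∑ α : ZMod p, (maxWindow X L α : ℝ))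
      ≤ p * (1 + T + 256 * n * (1 + Real.log n) / (T : ℝ) ^ 2) := by
  have hlog : 0 ≤ Real.log n := Real.log_nonneg (by exact_mod_cast hn)
  have hT0 : (0 : ℝ) < T := by exact_mod_cast (by omega : 0 < T)
  have hlayer : ∀ α : ZMod p, maxWindow X L α
      ≤ T + ∑ k ∈ Finset.Ioc T n, if k ≤ maxWindow X L α then 1 else 0 := by
    intro α
    have hM := maxWindow_le_card X L α
    rw [hX] at hM
    rw [Finset.sum_boole, Nat.cast_id]
    have : Finset.Ioc T (maxWindow X L α) ⊆
        (Finset.Ioc T n).filter fun k => k ≤ maxWindow X L α := by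
      intro k hk
      have := Finset.mem_Ioc.1 hk
      exact Finset.mem_filter.2 ⟨Finset.mem_Ioc.2 ⟨this.1, this.2.trans hM⟩, this.2⟩
    have := Finset.card_le_card this
    rw [Nat.card_Ioc] at this
    omega
  have hcard : ((Finset.univ.erase (0 : ZMod p)).card : ℝ) ≤ p := by
    have : (Finset.univ.erase (0 : ZMod p)).card ≤ p :=
      (Finset.card_le_card (Finset.erase_subset _ _)).trans_eq (by simp [ZMod.card])
    exact_mod_cast this
  have hcubes : ∑ k ∈ Finset.Ioc T n, (1 : ℝ) / (k : ℝ) ^ 3 ≤ 1 / (T : ℝ) ^ 2 := by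
    rcases le_or_gt T n with hTn | hTn
    · calc _ ≤ ∑ k ∈ Finset.Ioc T n, 1 / (T : ℝ) * ((k : ℝ) ^ 2)⁻¹ := by
            refine Finset.sum_le_sum fun k hk => ?_
            have hk' : (T : ℝ) ≤ k := by exact_mod_cast (Finset.mem_Ioc.1 hk).1.le
            rw [← one_div, div_mul_div_comm, mul_one, pow_succ' (k : ℝ) 2]
            have : 0 < (k : ℝ) := hT0.trans_le hk'
            gcongr
        _ ≤ 1 / (T : ℝ) * (T : ℝ)⁻¹ := by
            rw [← Finset.mul_sum]
            have := sum_Ioc_inv_sq_le_sub (α := ℝ) (by omega : T ≠ 0) hTn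
            have h0 : (0 : ℝ) ≤ (n : ℝ)⁻¹ := by positivity
            gcongr
            linarith
        _ = _ := by field_simp
    · rw [Finset.Ioc_eq_empty (by omega), Finset.sum_empty]
      positivity
  rw [← Finset.add_sum_erase _ _ (Finset.mem_univ (0 : ZMod p))]
  have hzero : (maxWindow X L (0 : ZMod p) : ℝ) ≤ p := by
    exact_mod_cast (maxWindow_le_card X L 0).trans (hX.le.trans hnp)
  have hrest : ∑ α ∈ Finset.univ.erase (0 : ZMod p), (maxWindow X L α : ℝ)
      ≤ p * T + 256 * n * p * (1 + Real.log n) * (1 / (T : ℝ) ^ 2) := by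
    calc _ ≤ ∑ α ∈ Finset.univ.erase (0 : ZMod p),
          ((T : ℝ) + ∑ k ∈ Finset.Ioc T n, if k ≤ maxWindow X L α then (1 : ℝ) else 0) := by
          refine Finset.sum_le_sum fun α _ => ?_
          exact_mod_cast hlayer α
      _ = ((Finset.univ.erase (0 : ZMod p)).card : ℝ) * T + ∑ k ∈ Finset.Ioc T n,
          (((Finset.univ.erase (0 : ZMod p)).filter fun α => k ≤ maxWindow X L α).card : ℝ) := by
          rw [Finset.sum_add_distrib, Finset.sum_const, nsmul_eq_mul, Finset.sum_comm]
          simp_rw [Finset.sum_boole]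
      _ ≤ p * T + ∑ k ∈ Finset.Ioc T n, 256 * n * p * (1 + Real.log n) * (1 / (k : ℝ) ^ 3) := by
          gcongr with k hk
          have := Finset.mem_Ioc.1 hk
          rw [mul_one_div]
          exact card_rich_le X L n k hX (by omega) this.2 hnp hL
      _ ≤ _ := by
          rw [← Finset.mul_sum]
          gcongr
  calc _ ≤ (p : ℝ) + (p * T + 256 * n * p * (1 + Real.log n) * (1 / (T : ℝ) ^ 2)) :=
        add_le_add hzero hrest
    _ = _ := by ring

theorem exists_dilation_chain_le_maxWindow {p m : ℕ} [Fact p.Prime] [NeZero m] (hmp : m ≤ p)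
    (X : Finset (ZMod p)) :
    ∃ ν : ZMod p, ν ≠ 0 ∧ ∀ (a b : ZMod p) (y : ZMod m),
      (X.filter fun x => ((ZMod.val (a * x + b) : ℕ) : ZMod m) = y).card
        ≤ maxWindow X ((p - 1) / m) (ν * a) := by
  have hp := (Fact.out : p.Prime).pos
  have hm : 0 < m := Nat.pos_of_ne_zero (NeZero.ne m)
  obtain ⟨ν, hν, hνm⟩ : ∃ ν : ZMod p, ν ≠ 0 ∧
      ∀ t : ℕ, t ≤ (p - 1) / m → ν * ((m : ZMod p) * t) = t := by
    rcases hmp.lt_or_eq with h | rfl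
    · have hm0 : (m : ZMod p) ≠ 0 := by
        rw [Ne, ZMod.natCast_eq_zero_iff]
        exact fun hd => absurd (Nat.le_of_dvd hm hd) (not_le.2 h)
      exact ⟨(m : ZMod p)⁻¹, inv_ne_zero hm0, fun t _ => by
        rw [← mul_assoc, inv_mul_cancel₀ hm0, one_mul]⟩
    · refine ⟨1, one_ne_zero, fun t ht => ?_⟩
      rw [Nat.div_eq_of_lt (by omega)] at ht
      simp [Nat.le_zero.1 ht]
  refine ⟨ν, hν, fun a b y => ?_⟩
  refine le_trans (Finset.card_le_card ?_) (Finset.le_sup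
    (f := fun c : ZMod p => (X.filter fun x => (ν * a * x - c).val ≤ (p - 1) / m).card)
    (Finset.mem_univ (ν * y.val - ν * b)))
  intro x hx
  obtain ⟨hxX, hxy⟩ := Finset.mem_filter.1 hx
  refine Finset.mem_filter.2 ⟨hxX, ?_⟩
  set z : ZMod p := a * x + b with hz
  have hmod : z.val % m = y.val := by rw [← hxy, ZMod.val_natCast]
  have hlt : z.val < p := ZMod.val_lt z
  have ht : z.val / m ≤ (p - 1) / m := Nat.div_le_div_right (by omega)
  have hdecomp : z = (y.val : ZMod p) + (m : ZMod p) * ((z.val / m : ℕ) : ZMod p) := by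
    have h := congrArg (Nat.cast : ℕ → ZMod p) (Nat.mod_add_div z.val m)
    rw [hmod] at h
    push_cast at h
    rw [ZMod.natCast_zmod_val] at h
    exact h.symm
  have heq : ν * a * x - (ν * (y.val : ZMod p) - ν * b) = ((z.val / m : ℕ) : ZMod p) := by
    have h1 : ν * z = ν * (y.val : ZMod p) + ((z.val / m : ℕ) : ZMod p) := by
      conv_lhs => rw [hdecomp]
      rw [mul_add, hνm _ ht]
    rw [hz] at h1 ⊢
    linear_combination h1
  rw [heq, ZMod.val_natCast]
  exact (Nat.mod_le _ _).trans ht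

/-- **Expected longest chain for `h(x) = ((a·x + b) mod p) mod m`.**
Let `p` be a prime, `p ≥ m ≥ n ≥ 2`, and `X ⊆ Z_p` with `|X| = n`. For `a, b`
uniform in `Z_p`, with `h(x) = (lift_p (a·x + b) : ZMod m)` and
`M = max_{y ∈ Z_m} |{x ∈ X : h x = y}|`, we have
`E[M] ≤ C · (n · log n)^(1/3)` for an absolute constant `C`. -/
theorem expected_max_chain_mod_p :
    ∃ C : ℝ, 0 < C ∧
      ∀ (p n m : ℕ) [NeZero p] [NeZero m], p.Prime → 2 ≤ n → n ≤ m → m ≤ p →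
        ∀ X : Finset (ZMod p), X.card = n →
          (∑ a : ZMod p, ∑ b : ZMod p,
              ((Finset.univ.sup (fun y : ZMod m =>
                (X.filter fun x => ((ZMod.val (a * x + b) : ℕ) : ZMod m) = y).card) : ℕ) : ℝ))
            / (p ^ 2 : ℝ)
          ≤ C * ((n : ℝ) * Real.log n) ^ ((1 : ℝ) / 3) := by
  refine ⟨1000, by norm_num, ?_⟩
  intro p n m _ _ hp hn hnm hmp X hX
  have : Fact p.Prime := ⟨hp⟩
  have hppos : (0 : ℝ) < p := by exact_mod_cast hp.pos
  have hlog2 : (1 / 2 : ℝ) ≤ Real.log 2 := by linarith [Real.log_two_gt_d9]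
  have hn2 : (2 : ℝ) ≤ n := by exact_mod_cast hn
  have hlog : Real.log 2 ≤ Real.log n := Real.log_le_log (by norm_num) hn2
  set Q : ℝ := ((n : ℝ) * Real.log n) ^ ((1 : ℝ) / 3) with hQ
  have hnl : 1 ≤ (n : ℝ) * Real.log n := by nlinarith
  have hQ1 : 1 ≤ Q := Real.one_le_rpow hnl (by norm_num)
  have hQ3 : Q ^ 3 = (n : ℝ) * Real.log n := by
    rw [hQ, ← Real.rpow_natCast, ← Real.rpow_mul (by linarith)]
    norm_num
  set T : ℕ := ⌈Q⌉₊ + 3 with hT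
  have hTQ : Q ≤ T := by
    rw [hT]; push_cast
    linarith [Nat.le_ceil Q]
  have hTQ' : (T : ℝ) ≤ 5 * Q := by
    rw [hT]; push_cast
    linarith [Nat.ceil_lt_add_one (by linarith : 0 ≤ Q)]
  obtain ⟨ν, hν, hchain⟩ := exists_dilation_chain_le_maxWindow hmp X
  have hL : n * ((p - 1) / m) < p := by
    have h1 : n * ((p - 1) / m) ≤ m * ((p - 1) / m) := Nat.mul_le_mul_right _ hnm
    have h2 := Nat.mul_div_le (p - 1) m
    have := hp.pos
    omega
  have hmain := sum_maxWindow_le X ((p - 1) / m) n T hX (by omega) (by omega)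
    (hnm.trans hmp) hL
  have hperm : ∑ a : ZMod p, (maxWindow X ((p - 1) / m) (ν * a) : ℝ)
      = ∑ α : ZMod p, (maxWindow X ((p - 1) / m) α : ℝ) :=
    Equiv.sum_comp (Equiv.mulLeft₀ ν hν) fun α => (maxWindow X ((p - 1) / m) α : ℝ)
  have hT2 : 256 * n * (1 + Real.log n) / (T : ℝ) ^ 2 ≤ 768 * Q := by
    rw [div_le_iff₀ (by positivity)]
    have h1 : Q ^ 2 ≤ (T : ℝ) ^ 2 := by gcongr
    have h2 : 1 + Real.log n ≤ 3 * Real.log n := by linarith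
    calc 256 * (n : ℝ) * (1 + Real.log n) ≤ 256 * n * (3 * Real.log n) := by gcongr
      _ = 768 * Q * Q ^ 2 := by linear_combination -768 * hQ3
      _ ≤ _ := by gcongr
  rw [div_le_iff₀ (by positivity)]
  calc _ ≤ ∑ a : ZMod p, ∑ _b : ZMod p, (maxWindow X ((p - 1) / m) (ν * a) : ℝ) := by
        refine Finset.sum_le_sum fun a _ => Finset.sum_le_sum fun b _ => ?_
        exact_mod_cast Finset.sup_le fun y _ => hchain a b y
    _ = p * ∑ α : ZMod p, (maxWindow X ((p - 1) / m) α : ℝ) := by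
        rw [← hperm, Finset.mul_sum]
        simp [ZMod.card]
    _ ≤ p * (p * (1 + T + 256 * n * (1 + Real.log n) / (T : ℝ) ^ 2)) := by gcongr
    _ ≤ p * (p * (1000 * Q)) := by
        gcongr
        linarith
    _ = _ := by ring
end

section
/- Let n, M, r be positive integers satisfying 4M ≤ n ≤ r, and let A ⊆ Z_r be a set of size n. Let B ⊆ Z_r^* be a set of size at most M satisfying: (1) for every b ∈ B, M < lift_r(b) < 2M; (2) for every pair of distinct b, b' ∈ B, the three integers lift_r(b), lift_r(b'), and r are pairwise coprime. Assume moreover that for every b ∈ B there exists an interval I_b ⊆ Z_r of size ⌈r/n⌉ such that |I_b ∩ bA| ≥ 4M. Then there exist at least M·|B| ordered pairs (a, a') of distinct elements of A such that ‖a − a'‖_r < r/(n·M). -/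
open Finset in
/-- If each of the sets `S b` is cut into at most `2M` clusters by `κ b`, and at most one
cluster of `S b` meets `S b'`, then many ordered pairs lie in a common cluster for some `b`. -/
theorem mul_card_le_card_of_clusters {α β ι : Type*} [DecidableEq α] [DecidableEq β]
    [DecidableEq ι] (M : ℕ) (B : Finset β) (hB : B.card ≤ M) (S : β → Finset α)
    (κ : β → α → ι) (K : β → Finset ι)
    (hS : ∀ b ∈ B, 4 * M ≤ (S b).card)
    (hK : ∀ b ∈ B, (K b).card ≤ 2 * M)
    (hκ : ∀ b ∈ B, ∀ x ∈ S b, κ b x ∈ K b)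
    (hmeet : ∀ b ∈ B, ∀ b' ∈ B, b ≠ b' → ∀ x ∈ S b, x ∈ S b' → ∀ y ∈ S b, y ∈ S b' →
      κ b x = κ b y)
    (F : Finset (α × α))
    (hF : ∀ b ∈ B, ∀ x ∈ S b, ∀ y ∈ S b, x ≠ y → κ b x = κ b y → (x, y) ∈ F) :
    M * B.card ≤ F.card := by
  classical
  let P : β → Finset (α × α) := fun b => (S b).offDiag.filter (fun p => κ b p.1 = κ b p.2)
  let mult : α × α → ℕ := fun p => #{b ∈ B | p ∈ P b}
  have hPF : ∀ b ∈ B, P b ⊆ F := by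
    rintro b hb ⟨x, y⟩ hp
    simp only [P, mem_filter, mem_offDiag] at hp
    exact hF b hb x hp.1.1 y hp.1.2.1 hp.1.2.2 hp.2
  have hdouble : ∑ b ∈ B, ∑ p ∈ P b, (1 : ℚ) / mult p ≤ F.card := by
    calc ∑ b ∈ B, ∑ p ∈ P b, (1 : ℚ) / mult p
        = ∑ p ∈ F, ∑ b ∈ B with p ∈ P b, (1 : ℚ) / mult p := by
          apply sum_comm'
          intro b p
          simp only [mem_filter]
          exact ⟨fun h => ⟨h, hPF b h.1 h.2⟩, fun h => h.1⟩
      _ ≤ ∑ p ∈ F, (1 : ℚ) := by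
          apply sum_le_sum
          intro p _
          rw [sum_const, nsmul_eq_mul, mul_one_div]
          exact div_self_le_one _
      _ = F.card := by simp
  have hone : ∀ b ∈ B, (M : ℚ) ≤ ∑ p ∈ P b, (1 : ℚ) / mult p := by
    intro b hb
    let C : ι → Finset α := fun c => (S b).filter (fun x => κ b x = c)
    let R : β → ι → Prop := fun b' c => b' = b ∨ ∃ x ∈ S b, x ∈ S b' ∧ κ b x = c
    let X : ι → ℕ := fun c => #{b' ∈ B | R b' c}
    have hX : ∑ c ∈ K b, X c + 1 ≤ 3 * M := by
      have hswap : ∑ c ∈ K b, X c = ∑ b' ∈ B, #{c ∈ K b | R b' c} := by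
        simp only [X, card_filter]
        exact sum_comm
      have hother : ∑ b' ∈ B.erase b, #{c ∈ K b | R b' c} ≤ ∑ b' ∈ B.erase b, 1 := by
        apply sum_le_sum
        intro b' hb'
        rw [mem_erase] at hb'
        rw [card_le_one]
        intro c hc c' hc'
        obtain ⟨-, h | ⟨x, hx, hx', rfl⟩⟩ := mem_filter.1 hc
        · exact absurd h hb'.1
        obtain ⟨-, h | ⟨y, hy, hy', rfl⟩⟩ := mem_filter.1 hc'
        · exact absurd h hb'.1
        exact hmeet b hb b' hb'.2 hb'.1.symm x hx hx' y hy hy'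
      have hself : #{c ∈ K b | R b c} ≤ 2 * M := (card_filter_le _ _).trans (hK b hb)
      rw [hswap, ← add_sum_erase B _ hb]
      rw [sum_const, smul_eq_mul, mul_one, card_erase_of_mem hb] at hother
      have : 0 < B.card := card_pos.2 ⟨b, hb⟩
      omega
    have hC : ∑ c ∈ K b, (C c).card = (S b).card :=
      (card_eq_sum_card_fiberwise (hκ b hb)).symm
    have hsplit : ∑ p ∈ P b, (1 : ℚ) / mult p
        = ∑ c ∈ K b, ∑ p ∈ (C c).offDiag, (1 : ℚ) / mult p := by
      rw [← sum_fiberwise_of_maps_to (s := P b) (t := K b) (g := fun p => κ b p.1)]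
      · apply sum_congr rfl
        intro c _
        apply sum_congr _ fun _ _ => rfl
        ext ⟨x, y⟩
        simp only [P, C, mem_filter, mem_offDiag]
        grind
      · intro p hp
        simp only [P, mem_filter, mem_offDiag] at hp
        exact hκ b hb _ hp.1.1
    have hcluster : ∀ c ∈ K b, ((C c).card : ℚ) - X c ≤
        ∑ p ∈ (C c).offDiag, (1 : ℚ) / mult p := by
      intro c _
      have hXpos : 1 ≤ X c := card_pos.2 ⟨b, mem_filter.2 ⟨hb, Or.inl rfl⟩⟩
      have hterm : ∀ p ∈ (C c).offDiag, (1 : ℚ) / X c ≤ 1 / mult p := by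
        rintro ⟨x, y⟩ hp
        simp only [C, mem_filter, mem_offDiag] at hp
        have hpos : 0 < mult (x, y) := by
          refine card_pos.2 ⟨b, ?_⟩
          simp only [P, mem_filter, mem_offDiag]
          grind
        have hle : mult (x, y) ≤ X c := by
          apply card_le_card
          intro b' hb'
          simp only [P, mem_filter, mem_offDiag] at hb'
          exact mem_filter.2 ⟨hb'.1, Or.inr ⟨x, hp.1.1, hb'.2.1.1, hp.1.2⟩⟩
        exact one_div_le_one_div_of_le (by exact_mod_cast hpos) (by exact_mod_cast hle)
      refine le_trans ?_ (card_nsmul_le_sum _ _ _ hterm)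
      rw [offDiag_card, nsmul_eq_mul, mul_one_div, Nat.cast_sub (Nat.le_mul_self _),
        le_div_iff₀ (by exact_mod_cast hXpos)]
      push_cast
      generalize (C c).card = m
      generalize X c = x at hXpos
      have hx : (1 : ℚ) ≤ x := by exact_mod_cast hXpos
      obtain rfl | rfl | hm : m = 0 ∨ m = 1 ∨ 2 ≤ m := by omega
      · push_cast; nlinarith
      · push_cast; nlinarith
      · have hm' : (2 : ℚ) ≤ m := by exact_mod_cast hm
        nlinarith [sq_nonneg ((m : ℚ) - 2 * x)]
    rw [hsplit]
    refine le_trans ?_ (sum_le_sum hcluster)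
    rw [sum_sub_distrib, ← Nat.cast_sum, ← Nat.cast_sum, hC]
    have h4 : ((4 * M : ℕ) : ℚ) ≤ (S b).card := by exact_mod_cast hS b hb
    have h3 : ((∑ c ∈ K b, X c + 1 : ℕ) : ℚ) ≤ (3 * M : ℕ) := by exact_mod_cast hX
    push_cast at h4 h3 ⊢
    linarith
  have htotal := (card_nsmul_le_sum B _ _ hone).trans hdouble
  rw [nsmul_eq_mul, mul_comm] at htotal
  exact_mod_cast htotal

theorem ZMod.min_val_le_natAbs {r : ℕ} [NeZero r] {z : ZMod r} {d : ℤ} (hd : (d : ZMod r) = z) :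
    min z.val (-z).val ≤ d.natAbs := by
  subst hd
  obtain h | h := Int.natAbs_eq d
  · refine (min_le_left _ _).trans ?_
    conv_lhs => rw [h]
    rw [Int.cast_natCast, ZMod.val_natCast]
    exact Nat.mod_le _ _
  · refine (min_le_right _ _).trans ?_
    conv_lhs => rw [h]
    rw [Int.cast_neg, neg_neg, Int.cast_natCast, ZMod.val_natCast]
    exact Nat.mod_le _ _

/-- Distinct coprime multipliers `b, b'` put all common points in the same cluster mod `b`. -/
theorem emod_eq_emod_of_coprime {b b' r : ℤ} (hcop : IsCoprime b b') (hb : 0 < b) (hb' : 0 < b')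
    {n : ℤ} (hbn : b + b' ≤ n) {t t' x y j₁ j₂ i₁ i₂ k₁ k₂ l₁ l₂ : ℤ}
    (hj₁ : 0 ≤ j₁) (hj₂ : 0 ≤ j₂) (hi₁ : 0 ≤ i₁) (hi₂ : 0 ≤ i₂)
    (hj₁' : j₁ * n < r) (hj₂' : j₂ * n < r) (hi₁' : i₁ * n < r) (hi₂' : i₂ * n < r)
    (hx : b * x = t + j₁ + k₁ * r) (hy : b * y = t + j₂ + k₂ * r)
    (hx' : b' * x = t' + i₁ + l₁ * r) (hy' : b' * y = t' + i₂ + l₂ * r) :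
    k₁ % b = k₂ % b := by
  have hn : 0 < n := by linarith
  have hr : 0 < r := lt_of_le_of_lt (by positivity) hj₁'
  set D := (k₁ - k₂) * b' - (l₁ - l₂) * b with hD
  have hDr : D * r = b * (i₁ - i₂) - b' * (j₁ - j₂) := by
    linear_combination b' * hy - b' * hx + b * hx' - b * hy'
  have hupper : D * n * r < n * r := by
    have : D * n * r = b * (i₁ * n) - b * (i₂ * n) - b' * (j₁ * n) + b' * (j₂ * n) := by
      linear_combination n * hDr
    nlinarith [mul_nonneg hb.le (mul_nonneg hi₂ hn.le), mul_nonneg hb'.le (mul_nonneg hj₁ hn.le),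
      mul_lt_mul_of_pos_left hi₁' hb, mul_lt_mul_of_pos_left hj₂' hb',
      mul_le_mul_of_nonneg_right hbn hr.le]
  have hlower : -n * r < D * n * r := by
    have : D * n * r = b * (i₁ * n) - b * (i₂ * n) - b' * (j₁ * n) + b' * (j₂ * n) := by
      linear_combination n * hDr
    nlinarith [mul_nonneg hb.le (mul_nonneg hi₁ hn.le), mul_nonneg hb'.le (mul_nonneg hj₂ hn.le),
      mul_lt_mul_of_pos_left hi₂' hb, mul_lt_mul_of_pos_left hj₁' hb',
      mul_le_mul_of_nonneg_right hbn hr.le]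
  have h1 : D < 1 := by
    have := lt_of_mul_lt_mul_right hupper hr.le
    nlinarith
  have h2 : -1 < D := by
    have := lt_of_mul_lt_mul_right hlower hr.le
    nlinarith
  have h0 : D = 0 := by omega
  have hdvd : b ∣ k₁ - k₂ :=
    hcop.dvd_of_dvd_mul_right ⟨l₁ - l₂, by linear_combination h0 - hD⟩
  exact Int.emod_eq_emod_iff_emod_sub_eq_zero.2 (Int.emod_eq_zero_of_dvd hdvd)


/-- The interval `I_r(t,s) = {t mod r, (t+1) mod r, …, (t+s−1) mod r}` in `Z_r`. -/
def Ival (r : ℕ) (t : ℤ) (s : ℕ) : Finset (ZMod r) :=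
  (Finset.range s).image (fun j : ℕ => ((t + (j : ℤ) : ℤ) : ZMod r))

/-- **The technical lemma.**  Let `4M ≤ n ≤ r`, `A ⊆ Z_r` with `|A| = n`, and let
`B ⊆ Z_r^*` with `|B| ≤ M` be such that every `b ∈ B` has `M < lift_r b < 2M`, and
for all distinct `b, b' ∈ B` the integers `lift_r b`, `lift_r b'`, `r` are pairwise
coprime.  If for every `b ∈ B` some interval `I_b` of size `⌈r/n⌉` satisfies
`|I_b ∩ bA| ≥ 4M`, then there are at least `M·|B|` ordered pairs of distinct
`a, a' ∈ A` with `‖a − a'‖_r < r/(n·M)`. -/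
theorem technical_lemma (n M r : ℕ) (hn : 0 < n) (hM : 0 < M) (hr : 0 < r)
    (h4M : 4 * M ≤ n) (hnr : n ≤ r)
    (A : Finset (ZMod r)) (hA : A.card = n)
    (B : Finset (ZMod r)) (hBunit : ∀ b ∈ B, IsUnit b) (hBcard : B.card ≤ M)
    (hBval : ∀ b ∈ B, M < ZMod.val b ∧ ZMod.val b < 2 * M)
    (hBcop : ∀ b ∈ B, ∀ b' ∈ B, b ≠ b' →
      Nat.Coprime (ZMod.val b) (ZMod.val b') ∧
      Nat.Coprime (ZMod.val b) r ∧ Nat.Coprime (ZMod.val b') r)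
    (hI : ∀ b ∈ B, ∃ t : ℤ,
      4 * M ≤ ((Ival r t (Nat.ceil ((r : ℚ) / n)) ∩ A.image (fun a => b * a)).card)) :
    M * B.card ≤
      ((A ×ˢ A).filter (fun q : ZMod r × ZMod r => q.1 ≠ q.2 ∧
        ((min (ZMod.val (q.1 - q.2)) (ZMod.val (q.2 - q.1)) : ℕ) : ℝ)
          < (r : ℝ) / ((n : ℝ) * (M : ℝ)))).card := by
  have : NeZero r := ⟨hr.ne'⟩
  have hnQ : (0 : ℚ) < n := by exact_mod_cast hn
  have hI' : ∀ b, ∃ t : ℤ, b ∈ B →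
      4 * M ≤ ((Ival r t (Nat.ceil ((r : ℚ) / n)) ∩ A.image (fun a => b * a)).card) := by
    intro b
    by_cases hb : b ∈ B
    · obtain ⟨t, ht⟩ := hI b hb
      exact ⟨t, fun _ => ht⟩
    · exact ⟨0, fun h => absurd h hb⟩
  choose t ht using hI'
  let S : ZMod r → Finset (ZMod r) := fun b =>
    A.filter (fun a => b * a ∈ Ival r (t b) (Nat.ceil ((r : ℚ) / n)))
  have hlift : ∀ b x, ∃ j k : ℤ, x ∈ S b → 0 ≤ j ∧ j * n < r ∧
      (b.val : ℤ) * x.val = t b + j + k * r := by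
    intro b x
    by_cases hx : x ∈ S b
    · obtain ⟨j, hj, hjx⟩ := Finset.mem_image.1 (Finset.mem_filter.1 hx).2
      rw [Finset.mem_range, Nat.lt_ceil, lt_div_iff₀ hnQ] at hj
      have hmod : (((t b + j : ℤ)) : ZMod r) = (((b.val : ℤ) * x.val : ℤ) : ZMod r) := by
        rw [hjx]
        push_cast
        rw [ZMod.natCast_zmod_val, ZMod.natCast_zmod_val]
      obtain ⟨k, hk⟩ := (ZMod.intCast_eq_intCast_iff_dvd_sub _ _ _).1 hmod
      exact ⟨j, k, fun _ => ⟨by positivity, by exact_mod_cast hj, by linear_combination hk⟩⟩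
    · exact ⟨0, 0, fun h => absurd h hx⟩
  choose j k hjk using hlift
  have hpos : ∀ b ∈ B, (0 : ℤ) < b.val := fun b hb => by
    have := hBval b hb
    omega
  refine mul_card_le_card_of_clusters M B hBcard S (fun b x => k b x % b.val)
    (fun b => Finset.Ico 0 (b.val : ℤ)) ?_ ?_ ?_ ?_ _ ?_
  · intro b hb
    refine (ht b hb).trans ((Finset.card_le_card ?_).trans
      (Finset.card_image_le (s := S b) (f := fun a => b * a)))
    intro z hz
    obtain ⟨hz, hz'⟩ := Finset.mem_inter.1 hz
    obtain ⟨a, ha, rfl⟩ := Finset.mem_image.1 hz'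
    exact Finset.mem_image_of_mem _ (Finset.mem_filter.2 ⟨ha, hz⟩)
  · intro b hb
    have := hBval b hb
    rw [Int.card_Ico]
    omega
  · intro b hb x _
    exact Finset.mem_Ico.2 ⟨Int.emod_nonneg _ (hpos b hb).ne', Int.emod_lt_of_pos _ (hpos b hb)⟩
  · intro b hb b' hb' hne x hx hx' y hy hy'
    obtain ⟨h1, h1', e1⟩ := hjk b x hx
    obtain ⟨h2, h2', e2⟩ := hjk b y hy
    obtain ⟨h3, h3', e3⟩ := hjk b' x hx'
    obtain ⟨h4, h4', e4⟩ := hjk b' y hy'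
    have hv := hBval b hb
    have hv' := hBval b' hb'
    exact emod_eq_emod_of_coprime (Nat.isCoprime_iff_coprime.2 (hBcop b hb b' hb' hne).1)
      (hpos b hb) (hpos b' hb') (n := n) (by omega) h1 h2 h3 h4 h1' h2' h3' h4' e1 e2 e3 e4
  · intro b hb x hx y hy hxy hκ
    obtain ⟨h1, h1', e1⟩ := hjk b x hx
    obtain ⟨h2, h2', e2⟩ := hjk b y hy
    refine Finset.mem_filter.2 ⟨Finset.mem_product.2
      ⟨(Finset.mem_filter.1 hx).1, (Finset.mem_filter.1 hy).1⟩, hxy, ?_⟩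
    obtain ⟨q, hq⟩ := Int.dvd_of_emod_eq_zero (Int.emod_eq_emod_iff_emod_sub_eq_zero.1 hκ)
    set d : ℤ := x.val - y.val - q * r with hd
    have hdb : b.val * d = j b x - j b y := by
      linear_combination (b.val : ℤ) * hd + e1 - e2 + r * hq
    have hcast : (d : ZMod r) = x - y := by
      rw [hd]
      push_cast
      rw [ZMod.natCast_zmod_val, ZMod.natCast_zmod_val, ZMod.natCast_self, mul_zero, sub_zero]
    have hmin := ZMod.min_val_le_natAbs hcast
    rw [neg_sub] at hmin
    have hdn : |d| * (n * M) < r := by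
      have hjn : |j b x - j b y| * n < r := by
        rw [← abs_of_nonneg (Int.natCast_nonneg n), ← abs_mul, abs_lt]
        constructor <;> nlinarith
      rw [← hdb, abs_mul, abs_of_pos (hpos b hb)] at hjn
      have hMb : (M : ℤ) ≤ b.val := by exact_mod_cast (hBval b hb).1.le
      nlinarith [mul_le_mul_of_nonneg_right hMb
        (mul_nonneg (abs_nonneg d) (Int.natCast_nonneg n))]
    have hnat : d.natAbs * (n * M) < r := by
      rw [Int.abs_eq_natAbs] at hdn
      exact_mod_cast hdn
    rw [lt_div_iff₀ (by positivity)]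
    exact_mod_cast (Nat.mul_le_mul_right (n * M) hmin).trans_lt hnat
end

section
/- Let q = 2^r for a positive integer r, let d ∈ Z_q with d ≠ 0, and let t be a real number with t ≥ 1. If a is chosen uniformly at random from the odd residues in Z_q, then Pr[ ‖a·d‖_q < t ] ≤ 4t/q. -/
/-- At least half of the residues modulo `2 ^ (s + 1)` are odd. -/
theorem two_pow_le_card_odd_residues (s : ℕ) :
    2 ^ s ≤ (Finset.univ.filter (fun a : ZMod (2 ^ (s + 1)) => ZMod.val a % 2 = 1)).card := by
  have hval : ∀ i < 2 ^ s, ZMod.val ((2 * i + 1 : ℕ) : ZMod (2 ^ (s + 1))) = 2 * i + 1 :=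
    fun i hi => ZMod.val_cast_of_lt (by rw [pow_succ]; omega)
  calc 2 ^ s = (Finset.range (2 ^ s)).card := (Finset.card_range _).symm
    _ ≤ _ := Finset.card_le_card_of_injOn
      (fun i => ((2 * i + 1 : ℕ) : ZMod (2 ^ (s + 1)))) ?_ ?_
  · intro i hi
    have hi' := hval i (by simpa using hi)
    simp only [Finset.coe_filter, Finset.mem_univ, true_and, Set.mem_ofPred_eq, hi']
    omega
  · intro i hi j hj hij
    have hi' := hval i (by simpa using hi)
    have hj' := hval j (by simpa using hj)
    simp only at hij
    rw [hij, hj'] at hi'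
    omega

/-- For `d ≠ 0`, at most `t` odd `a` have `lift (a * d) < t`: spread the
`2 ^ k` odd solutions `a` of `a * d = v` over the values `v, v - 1, …, v - 2 ^ k + 1`, where
`2 ^ k` is the power of two in `d`. -/
theorem card_odd_val_mul_lt_le (r : ℕ) (d : ZMod (2 ^ r)) (hd : d ≠ 0) (t : ℝ) (ht : 0 ≤ t) :
    ((Finset.univ.filter (fun a : ZMod (2 ^ r) =>
      ZMod.val a % 2 = 1 ∧ (ZMod.val (a * d) : ℝ) < t)).card : ℝ) ≤ t := by
  have hD : d.val ≠ 0 := by rwa [Ne, ZMod.val_eq_zero]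
  have hDlt : d.val < 2 ^ r := ZMod.val_lt d
  obtain ⟨k, m, hm, hkm⟩ := Nat.exists_eq_two_pow_mul_odd hD
  have hkr : k < r := by
    have hle : 2 ^ k ≤ d.val := hkm ▸ Nat.le_mul_of_pos_right _ hm.pos
    exact (Nat.pow_lt_pow_iff_right (by norm_num)).1 (hle.trans_lt hDlt)
  obtain ⟨e, rfl⟩ := Nat.exists_eq_add_of_lt hkr
  have hq : 2 ^ (k + e + 1) = 2 ^ k * 2 ^ (e + 1) := by rw [← pow_add, add_assoc]
  have hcop : ∀ n : ℕ, Nat.Coprime (2 ^ n) m :=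
    fun n => Nat.Coprime.pow_left n (Nat.coprime_two_left.2 hm)
  have hval : ∀ a : ZMod (2 ^ (k + e + 1)),
      ZMod.val (a * d) = 2 ^ k * (a.val * m % 2 ^ (e + 1)) := by
    intro a
    rw [ZMod.val_mul, hkm, mul_left_comm, ← Nat.mul_mod_mul_left]
    exact congrArg _ hq
  have hquot : ∀ a : ZMod (2 ^ (k + e + 1)), a.val / 2 ^ (e + 1) < 2 ^ k := by
    intro a
    rw [Nat.div_lt_iff_lt_mul (by positivity), ← hq]
    exact ZMod.val_lt a
  have hpos : ∀ a : ZMod (2 ^ (k + e + 1)), a.val % 2 = 1 → 2 ^ k ≤ ZMod.val (a * d) := by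
    intro a ha
    rw [hval]
    refine Nat.le_mul_of_pos_right _ (Nat.pos_of_ne_zero fun h => ?_)
    have h2 := (hcop (e + 1)).dvd_of_dvd_mul_right (Nat.dvd_of_mod_eq_zero h)
    have := (dvd_pow_self 2 (Nat.succ_ne_zero e)).trans h2
    omega
  refine le_trans ?_ (Nat.floor_le ht)
  have hcard : (Finset.Icc 1 ⌊t⌋₊).card = ⌊t⌋₊ := by simp
  rw [Nat.cast_le, ← hcard]
  refine Finset.card_le_card_of_injOn
    (fun a => ZMod.val (a * d) - a.val / 2 ^ (e + 1)) ?_ ?_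
  · intro a ha
    simp only [Finset.coe_filter, Finset.mem_univ, true_and, Set.mem_ofPred_eq] at ha
    have h1 := hpos a ha.1
    have h2 := hquot a
    have h3 := Nat.le_floor ha.2.le
    simp only [Finset.coe_Icc, Set.mem_Icc]
    generalize a.val / 2 ^ (e + 1) = j at *
    omega
  · intro a ha b hb hab
    simp only [Finset.coe_filter, Finset.mem_univ, true_and, Set.mem_ofPred_eq] at ha hb
    have ha1 := hpos a ha.1
    have hb1 := hpos b hb.1
    have ha2 := hquot a
    have hb2 := hquot b
    simp only at hab
    have hsum : ZMod.val (a * d) + b.val / 2 ^ (e + 1) =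
        ZMod.val (b * d) + a.val / 2 ^ (e + 1) := by omega
    have hdiv : b.val / 2 ^ (e + 1) = a.val / 2 ^ (e + 1) := by
      have := congrArg (· % 2 ^ k) hsum
      simpa [hval, Nat.mul_add_mod, Nat.mod_eq_of_lt ha2, Nat.mod_eq_of_lt hb2] using this
    have hmul : a.val * m % 2 ^ (e + 1) = b.val * m % 2 ^ (e + 1) := by
      refine Nat.eq_of_mul_eq_mul_left (Nat.two_pow_pos k) ?_
      rw [← hval, ← hval]
      omega
    have hmod : a.val % 2 ^ (e + 1) = b.val % 2 ^ (e + 1) :=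
      Nat.ModEq.cancel_right_of_coprime (hcop (e + 1)) hmul
    refine ZMod.val_injective _ ?_
    rw [← Nat.div_add_mod a.val (2 ^ (e + 1)), ← Nat.div_add_mod b.val (2 ^ (e + 1)), hdiv, hmod]

/-- **Small-norm probability mod a power of two.**
Let `q = 2^r` with `r ≥ 1`, `d ∈ Z_q` with `d ≠ 0`, and `t ≥ 1` real. For `a`
uniform among the odd residues of `Z_q`, `Pr[ ‖a·d‖_q < t ] ≤ 4t/q`, where
`‖x‖_q = min (lift_q x) (lift_q (−x))`. -/
theorem small_norm_prob_pow_two (r : ℕ) (hr : 0 < r)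
    (d : ZMod (2 ^ r)) (hd : d ≠ 0) (t : ℝ) (ht : 1 ≤ t) :
    (((Finset.univ.filter (fun a : ZMod (2 ^ r) => ZMod.val a % 2 = 1)).filter
        (fun a : ZMod (2 ^ r) =>
          ((min (ZMod.val (a * d)) (ZMod.val (-(a * d))) : ℕ) : ℝ) < t)).card : ℝ)
      / ((Finset.univ.filter (fun a : ZMod (2 ^ r) => ZMod.val a % 2 = 1)).card : ℝ)
    ≤ 4 * t / (2 ^ r : ℝ) := by
  have hval_neg : ∀ a : ZMod (2 ^ r), a.val % 2 = 1 → (-a).val % 2 = 1 := by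
    intro a ha
    have ha0 : a ≠ 0 := by
      rintro rfl
      simp at ha
    have hlt := ZMod.val_lt a
    have h2 : 2 ∣ 2 ^ r := dvd_pow_self 2 hr.ne'
    rw [ZMod.neg_val, if_neg ha0]
    omega
  set A := Finset.univ.filter (fun a : ZMod (2 ^ r) =>
    ZMod.val a % 2 = 1 ∧ (ZMod.val (a * d) : ℝ) < t) with hA
  have hAcard : (A.card : ℝ) ≤ t := card_odd_val_mul_lt_le r d hd t (by linarith)
  have hsub : (Finset.univ.filter (fun a : ZMod (2 ^ r) => ZMod.val a % 2 = 1)).filter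
      (fun a : ZMod (2 ^ r) =>
        ((min (ZMod.val (a * d)) (ZMod.val (-(a * d))) : ℕ) : ℝ) < t) ⊆
      A ∪ A.image (fun a => -a) := by
    intro a ha
    simp only [Finset.mem_filter, Finset.mem_univ, true_and, Nat.cast_min, min_lt_iff] at ha
    obtain ⟨hodd, h | h⟩ := ha
    · exact Finset.mem_union_left _ (Finset.mem_filter.2 ⟨Finset.mem_univ _, hodd, h⟩)
    · refine Finset.mem_union_right _ (Finset.mem_image.2 ⟨-a, ?_, neg_neg a⟩)
      simp only [hA, Finset.mem_filter, Finset.mem_univ, true_and, neg_mul]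
      exact ⟨hval_neg a hodd, h⟩
  have hnum := (Finset.card_le_card hsub).trans ((Finset.card_union_le _ _).trans
    (Nat.add_le_add_left Finset.card_image_le _))
  have hnum' := (Nat.cast_le (α := ℝ)).2 hnum
  rw [Nat.cast_add] at hnum'
  obtain ⟨s, rfl⟩ := Nat.exists_eq_add_one.2 hr
  have hden : (2 : ℝ) ^ s ≤
      (Finset.univ.filter (fun a : ZMod (2 ^ (s + 1)) => ZMod.val a % 2 = 1)).card := by
    exact_mod_cast two_pow_le_card_odd_residues s
  calc _ ≤ 2 * t / (2 : ℝ) ^ s := div_le_div₀ (by linarith) (hnum'.trans (by linarith)) (by positivity) hden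
    _ = 4 * t / 2 ^ (s + 1) := by
      rw [pow_succ]
      field_simp
      norm_num
end

section
/- Let r be a positive integer, let b ∈ Z_r^* and set k = lift_r(b), and assume gcd(k, r) = 1 and 1 ≤ k ≤ r. Let I ⊆ Z_r be an interval of size s with 1 ≤ s ≤ r. Then the set b^{−1}·I = {b^{−1}·x : x ∈ I} can be written as a union of k pairwise disjoint intervals in Z_r, each of size at most ⌈s/k⌉. -/
theorem mem_Ival {r : ℕ} {t : ℤ} {s : ℕ} {x : ZMod r} :
    x ∈ Ival r t s ↔ ∃ j < s, ((t : ZMod r) + j) = x := by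
  simp [Ival]

/-- The `m`-values in the residue class of `i` modulo `k` below `s` form an initial segment. -/
theorem lt_sub_add_sub_div_iff {s i k m : ℕ} (hk : 1 ≤ k) :
    m < (s - i + (k - 1)) / k ↔ i + k * m < s := by
  rw [Nat.lt_iff_add_one_le, Nat.le_div_iff_mul_le hk, Nat.add_mul, mul_comm m k]
  omega

/-- An interval of length at most `r` has no repetitions modulo `r`. -/
theorem ZMod.natCast_inj_of_lt {r a c : ℕ} (ha : a < r) (hc : c < r)
    (h : (a : ZMod r) = c) : a = c :=
  Nat.ModEq.eq_of_lt_of_lt ((ZMod.natCast_eq_natCast_iff a c r).mp h) ha hc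

/-- If `T` represents `b⁻¹ * (t + i)`, the interval starting at `T` consists of the elements
`b⁻¹ * (t + n)` with `n < s` running through the residue class of `i` modulo `b`. -/
theorem mem_Ival_residue_class_iff {r : ℕ} {b : ZMod r} (hb : IsUnit b) {k : ℕ} (hk : 1 ≤ k)
    (hkb : (k : ZMod r) = b) {t T : ℤ} {s i : ℕ} (hT : (T : ZMod r) = b⁻¹ * (t + i))
    {x : ZMod r} :
    x ∈ Ival r T ((s - i + (k - 1)) / k) ↔
      ∃ m, i + k * m < s ∧ b⁻¹ * (t + (i + k * m : ℕ)) = x := by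
  have hshift (m : ℕ) : (T : ZMod r) + m = b⁻¹ * (t + (i + k * m : ℕ)) := by
    push_cast
    rw [hT, hkb]
    linear_combination (-(m : ZMod r)) * ZMod.inv_mul_of_unit b hb
  simp only [mem_Ival, lt_sub_add_sub_div_iff hk, hshift]

/-- **Splitting `b⁻¹·I` into intervals.**
Let `b ∈ Z_r^*` with `k = lift_r b`, `gcd(k, r) = 1` and `1 ≤ k ≤ r`, and let
`I ⊆ Z_r` be an interval of size `s` with `1 ≤ s ≤ r`.  Then `b⁻¹·I` is a union
of `k` pairwise disjoint intervals, each of size at most `⌈s/k⌉`. -/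
theorem inv_mul_interval_eq_union_intervals (r : ℕ) (hr : 0 < r)
    (b : ZMod r) (hb : IsUnit b) (k : ℕ) (hk : k = ZMod.val b)
    (hcop : Nat.Coprime k r) (hk1 : 1 ≤ k) (hkr : k ≤ r)
    (I : Finset (ZMod r)) (s : ℕ) (hs1 : 1 ≤ s) (hsr : s ≤ r)
    (t : ℤ) (hI : I = Ival r t s) :
    ∃ (T : Fin k → ℤ) (S : Fin k → ℕ),
      (∀ j, S j ≤ Nat.ceil ((s : ℚ) / (k : ℚ))) ∧
      (∀ j j', j ≠ j' → Disjoint (Ival r (T j) (S j)) (Ival r (T j') (S j'))) ∧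
      I.image (fun x => b⁻¹ * x) = Finset.univ.biUnion (fun j => Ival r (T j) (S j)) := by
  have : NeZero r := ⟨hr.ne'⟩
  have hkb : (k : ZMod r) = b := by rw [hk, ZMod.natCast_zmod_val]
  let T : Fin k → ℤ := fun i => (b⁻¹ * ((t : ZMod r) + (i : ℕ))).val
  have hT (i : Fin k) : (T i : ZMod r) = b⁻¹ * (t + (i : ℕ)) := by simp [T]
  refine ⟨T, fun i => (s - i + (k - 1)) / k, fun i => ?_, fun i i' hne => ?_, ?_⟩
  · rw [← not_lt, lt_sub_add_sub_div_iff hk1, not_lt]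
    have hk0 : (0 : ℚ) < k := by exact_mod_cast hk1
    have hle : (s : ℚ) ≤ k * ⌈(s : ℚ) / k⌉₊ := by
      rw [← div_le_iff₀' hk0]
      exact Nat.le_ceil _
    exact le_add_left (by exact_mod_cast hle)
  · refine Finset.disjoint_left.mpr fun x hx hx' => hne (Fin.ext ?_)
    obtain ⟨m, hm, rfl⟩ := (mem_Ival_residue_class_iff hb hk1 hkb (hT i)).mp hx
    obtain ⟨m', hm', h⟩ := (mem_Ival_residue_class_iff hb hk1 hkb (hT i')).mp hx'
    have hinv : IsUnit b⁻¹ := IsUnit.of_mul_eq_one b (ZMod.inv_mul_of_unit b hb)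
    have heq := ZMod.natCast_inj_of_lt (hm'.trans_le hsr) (hm.trans_le hsr)
      (add_left_cancel (hinv.mul_left_cancel h))
    simpa [Nat.mod_eq_of_lt] using (congrArg (· % k) heq).symm
  · ext x
    simp only [hI, Finset.mem_image, Finset.mem_biUnion, Finset.mem_univ, true_and,
      mem_Ival_residue_class_iff hb hk1 hkb (hT _), mem_Ival]
    constructor
    · rintro ⟨_, ⟨n, hn, rfl⟩, rfl⟩
      exact ⟨⟨n % k, Nat.mod_lt n hk1⟩, n / k, by rwa [Nat.mod_add_div], by rw [Nat.mod_add_div]⟩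
    · rintro ⟨i, m, hm, rfl⟩
      exact ⟨_, ⟨_, hm, rfl⟩, rfl⟩
end

section
/- Let n, M, r be positive integers with 4M ≤ n ≤ r. Let b, b' ∈ Z_r^* be distinct elements such that M < lift_r(b) < 2M, M < lift_r(b') < 2M, and the integers lift_r(b), lift_r(b'), and r are pairwise coprime. Let I and I' be intervals in Z_r each of size ⌈r/n⌉. Then the set b^{−1}·I ∩ b'^{−1}·I' is either empty or an interval in Z_r. -/
theorem mem_Ival_iff {r s : ℕ} {t : ℤ} {y : ZMod r} :
    y ∈ Ival r t s ↔ ∃ Y : ℤ, (Y : ZMod r) = y ∧ t ≤ Y ∧ Y < t + s := by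
  simp only [Ival, Finset.mem_image, Finset.mem_range]
  constructor
  · rintro ⟨j, hj, rfl⟩
    exact ⟨t + j, rfl, by omega, by omega⟩
  · rintro ⟨Y, rfl, h₁, h₂⟩
    refine ⟨(Y - t).toNat, by omega, ?_⟩
    rw [Int.toNat_of_nonneg (by omega), add_sub_cancel]

/-- The integers representing elements of `b⁻¹·I` are those whose multiple by `lift_r b` lies in
one of the `r`-translates of the integer interval defining `I`. -/
theorem intCast_mem_image_inv_mul_Ival {r s : ℕ} [NeZero r] {t : ℤ} {b : ZMod r} (hb : IsUnit b)
    (Y : ℤ) :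
    (Y : ZMod r) ∈ (Ival r t s).image (fun x => b⁻¹ * x) ↔
      ∃ k : ℤ, t + k * r ≤ b.val * Y ∧ (b.val : ℤ) * Y < t + k * r + s := by
  have hcast : ((b.val * Y : ℤ) : ZMod r) = b * Y := by simp
  have hmem : (Y : ZMod r) ∈ (Ival r t s).image (fun x => b⁻¹ * x) ↔
      ((b.val * Y : ℤ) : ZMod r) ∈ Ival r t s := by
    rw [hcast, Finset.mem_image]
    constructor
    · rintro ⟨x, hx, h⟩
      rwa [← h, ← mul_assoc, ZMod.mul_inv_of_unit b hb, one_mul]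
    · intro h
      exact ⟨_, h, by rw [← mul_assoc, ZMod.inv_mul_of_unit b hb, one_mul]⟩
  rw [hmem, mem_Ival_iff]
  constructor
  · rintro ⟨Z, hZ, h₁, h₂⟩
    obtain ⟨k, hk⟩ := (ZMod.intCast_eq_intCast_iff_dvd_sub Z _ r).1 hZ
    exact ⟨k, by linarith, by linarith⟩
  · rintro ⟨k, h₁, h₂⟩
    exact ⟨b.val * Y - k * r, by simp, by linarith, by linarith⟩

/-- The integer points of two real intervals with positive integer denominators form an integer
interval. -/
theorem exists_Icc_iff_mul_bounds {p q : ℤ} (hp : 0 < p) (hq : 0 < q) (a c a' c' : ℤ) :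
    ∃ lo hi : ℤ, ∀ x : ℤ,
      ((a ≤ p * x ∧ p * x < c) ∧ (a' ≤ q * x ∧ q * x < c')) ↔ lo ≤ x ∧ x < hi := by
  have lower {m : ℤ} (hm : 0 < m) (d x : ℤ) : d ≤ m * x ↔ -(-d / m) ≤ x := by
    rw [neg_le, Int.le_ediv_iff_mul_le hm, neg_mul, neg_le_neg_iff, mul_comm]
  have upper {m : ℤ} (hm : 0 < m) (d x : ℤ) : m * x < d ↔ x < -(-d / m) := by
    rw [← not_le, lower hm, not_le]
  refine ⟨max (-(-a / p)) (-(-a' / q)), min (-(-c / p)) (-(-c' / q)), fun x => ?_⟩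
  rw [lower hp, upper hp, lower hq, upper hq, max_le_iff, lt_min_iff]
  tauto

/-- Two common points of the periodic unions `⋃ₖ [t + k r, t + k r + s) / p` and
`⋃ₖ [t' + k r, t' + k r + s) / q` lie, up to a common translation by a multiple of `r`, in the
same pair of intervals. -/
theorem exists_common_translation {p q r s t t' x y k k' l l' : ℤ}
    (hp : 0 < p) (hq : 0 < q) (hr : 0 < r) (hcop : IsCoprime p q)
    (hs : (s - 1) * (p + q) < r)
    (hx : t + k * r ≤ p * x ∧ p * x < t + k * r + s)
    (hx' : t' + k' * r ≤ q * x ∧ q * x < t' + k' * r + s)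
    (hy : t + l * r ≤ p * y ∧ p * y < t + l * r + s)
    (hy' : t' + l' * r ≤ q * y ∧ q * y < t' + l' * r + s) :
    ∃ m : ℤ, l = k + p * m ∧ l' = k' + q * m := by
  set D := q * (l - k) - p * (l' - k') with hD
  have key : r * D = p * (q * (y - x) - (l' - k') * r) - q * (p * (y - x) - (l - k) * r) := by
    rw [hD]; ring
  have h₁ : p * (y - x) - (l - k) * r ≤ s - 1 := by linarith
  have h₂ : -(s - 1) ≤ p * (y - x) - (l - k) * r := by linarith
  have h₃ : q * (y - x) - (l' - k') * r ≤ s - 1 := by linarith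
  have h₄ : -(s - 1) ≤ q * (y - x) - (l' - k') * r := by linarith
  have hlt : r * D < r * 1 := by
    linarith [mul_le_mul_of_nonneg_left h₃ hp.le, mul_le_mul_of_nonneg_left h₂ hq.le]
  have hgt : r * (-1) < r * D := by
    linarith [mul_le_mul_of_nonneg_left h₄ hp.le, mul_le_mul_of_nonneg_left h₁ hq.le]
  have hD₀ : D = 0 := by
    have := lt_of_mul_lt_mul_left hlt hr.le
    have := lt_of_mul_lt_mul_left hgt hr.le
    omega
  have heq : q * (l - k) = p * (l' - k') := by linarith
  obtain ⟨m, hm⟩ := hcop.dvd_of_dvd_mul_left (Dvd.intro _ heq.symm)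
  refine ⟨m, by linarith, ?_⟩
  have : p * (l' - k') = p * (q * m) := by rw [← heq, hm]; ring
  linarith [mul_left_cancel₀ hp.ne' this]

theorem ceil_div_sub_one_mul_lt {r n : ℕ} (hn : 0 < n) (hr : 0 < r) :
    ((⌈(r : ℚ) / n⌉₊ : ℤ) - 1) * n < r := by
  have hn' : (0 : ℚ) < n := by exact_mod_cast hn
  have h := Nat.ceil_lt_add_one (show (0 : ℚ) ≤ (r : ℚ) / n by positivity)
  have hmul : ((⌈(r : ℚ) / n⌉₊ : ℚ) - 1) * n < r := by
    rw [← lt_div_iff₀ hn']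
    linarith
  exact_mod_cast hmul

/-- **Intersections `b⁻¹·I ∩ b'⁻¹·I'` are empty or intervals.**
Let `4M ≤ n ≤ r`, and let `b ≠ b'` be units of `Z_r` with `M < lift_r b < 2M`,
`M < lift_r b' < 2M`, and `lift_r b`, `lift_r b'`, `r` pairwise coprime.  If `I`
and `I'` are intervals in `Z_r` of size `⌈r/n⌉`, then `b⁻¹·I ∩ b'⁻¹·I'` is
either empty or an interval in `Z_r`. -/
theorem inv_mul_interval_inter (n M r : ℕ) (hn : 0 < n) (hM : 0 < M) (hr : 0 < r)
    (h4M : 4 * M ≤ n) (hnr : n ≤ r)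
    (b b' : ZMod r) (hbu : IsUnit b) (hbu' : IsUnit b') (hne : b ≠ b')
    (hb : M < ZMod.val b ∧ ZMod.val b < 2 * M)
    (hb' : M < ZMod.val b' ∧ ZMod.val b' < 2 * M)
    (hcop : Nat.Coprime (ZMod.val b) (ZMod.val b'))
    (hcopr : Nat.Coprime (ZMod.val b) r) (hcopr' : Nat.Coprime (ZMod.val b') r)
    (t t' : ℤ) :
    ((Ival r t (Nat.ceil ((r : ℚ) / (n : ℚ)))).image (fun x => b⁻¹ * x)
        ∩ (Ival r t' (Nat.ceil ((r : ℚ) / (n : ℚ)))).image (fun x => b'⁻¹ * x)) = ∅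
    ∨ ∃ (u : ℤ) (s : ℕ), 0 < s ∧
        ((Ival r t (Nat.ceil ((r : ℚ) / (n : ℚ)))).image (fun x => b⁻¹ * x)
          ∩ (Ival r t' (Nat.ceil ((r : ℚ) / (n : ℚ)))).image (fun x => b'⁻¹ * x)) = Ival r u s := by
  have : NeZero r := ⟨hr.ne'⟩
  set s := ⌈(r : ℚ) / n⌉₊
  have hp : (0 : ℤ) < b.val := by omega
  have hq : (0 : ℤ) < b'.val := by omega
  have hrZ : (0 : ℤ) < r := by omega
  have hceil : ((s : ℤ) - 1) * n < r := ceil_div_sub_one_mul_lt hn hr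
  have hs : ((s : ℤ) - 1) * (b.val + b'.val) < r := by
    have hs₁ : 0 < s := Nat.ceil_pos.2 (by positivity)
    have : ((s : ℤ) - 1) * (b.val + b'.val) ≤ (s - 1) * n :=
      mul_le_mul_of_nonneg_left (by omega) (by omega)
    linarith
  rcases Finset.eq_empty_or_nonempty ((Ival r t s).image (fun x => b⁻¹ * x)
    ∩ (Ival r t' s).image (fun x => b'⁻¹ * x)) with h | ⟨x, hx⟩
  · exact Or.inl h
  right
  obtain ⟨x, rfl⟩ := ZMod.intCast_surjective x
  simp only [Finset.mem_inter, intCast_mem_image_inv_mul_Ival hbu,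
    intCast_mem_image_inv_mul_Ival hbu'] at hx
  obtain ⟨⟨k, hk⟩, k', hk'⟩ := hx
  obtain ⟨lo, hi, hIcc⟩ := exists_Icc_iff_mul_bounds hp hq
    (t + k * r) (t + k * r + s) (t' + k' * r) (t' + k' * r + s)
  have hx := (hIcc x).1 ⟨hk, hk'⟩
  refine ⟨lo, (hi - lo).toNat, by omega, ?_⟩
  ext y
  rw [mem_Ival_iff, Int.toNat_of_nonneg (by omega), add_sub_cancel]
  constructor
  · obtain ⟨y, rfl⟩ := ZMod.intCast_surjective y
    simp only [Finset.mem_inter, intCast_mem_image_inv_mul_Ival hbu,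
      intCast_mem_image_inv_mul_Ival hbu']
    rintro ⟨⟨l, hl⟩, l', hl'⟩
    obtain ⟨m, rfl, rfl⟩ := exists_common_translation hp hq hrZ
      (Nat.isCoprime_iff_coprime.2 hcop) hs hk hk' hl hl'
    refine ⟨y - m * r, by simp, (hIcc _).1 ⟨⟨?_, ?_⟩, ?_, ?_⟩⟩ <;> linarith
  · rintro ⟨y, rfl, hy⟩
    have := (hIcc y).2 hy
    simp only [Finset.mem_inter, intCast_mem_image_inv_mul_Ival hbu,
      intCast_mem_image_inv_mul_Ival hbu']
    exact ⟨⟨k, this.1⟩, k', this.2⟩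
end
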